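/- arXiv:2311.08102 — 3 statements merged into one kernel-verified Lean document; each statement's English description precedes it below -/
import Mathlib

section
/- (Theorem 1) Fix an integer $m\ge 3$, constants $c>0$, $\lambda>0$, and a real parameter $a>0$ (playing the role of $c\Vert\boldsymbol\alpha\Vert$). Let $\xi_n$ be given by $\xi_{2r}=0$ and $\xi_{2r+1}=\frac{(2r-1)!!}{(2r)!!}\cdot\frac{m-2}{2r+m-2}\,a^{2r}$, and let $\zeta_n$ be defined by $\zeta_1=1$, $\zeta_n=\xi_n+\lambda\sum_{k=1}^{n-1}\zeta_{n-k}\xi_k$ for $n\ge 2$. Define $H(t)=e^{-\lambda t}\sqrt{\pi}\sum_{n=1}^{\infty}\frac{\zeta_n}{\Gamma(n/2)}\left(\frac{t}{2a}\right)^{(n-1)/2}J_{(n-1)/2}(at)$. Then for every real $s>0$, $\int_0^{\infty}e^{-st}H(t)\,dt=\dfrac{F\left(\frac{1}{2},\frac{m-2}{2};\frac{m}{2};\frac{a^2}{(s+\lambda)^2+a^2}\right)}{\sqrt{(s+\lambda)^2+a^2}-\lambda F\left(\frac{1}{2},\frac{m-2}{2};\frac{m}{2};\frac{a^2}{(s+\lambda)^2+a^2}\right)}$.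 -/
/-- Pochhammer symbol `(a)_n = a(a+1)⋯(a+n-1)` for a real `a`. -/
noncomputable def poch (a : ℝ) (n : ℕ) : ℝ := (ascPochhammer ℝ n).eval a

/-- Gauss hypergeometric series `F(α,β;γ;x) = ∑ (α)_l (β)_l / ((γ)_l l!) x^l`. -/
noncomputable def hypF (α β γ x : ℝ) : ℝ :=
  ∑' l : ℕ, (poch α l * poch β l) / (poch γ l * l.factorial) * x ^ l

/-- Bessel function of the first kind of real order `ν`. -/
noncomputable def besselJ (ν z : ℝ) : ℝ :=
  ∑' k : ℕ, (-1 : ℝ) ^ k / (k.factorial * Real.Gamma ((k : ℝ) + ν + 1))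
      * (z / 2) ^ (2 * (k : ℝ) + ν)

section

open Real Filter Topology MeasureTheory
open Finset.HasAntidiagonal (antidiagonal)

/-! ### Coefficients of `(1 - x) ^ (-α)` -/

lemma poch_zero (a : ℝ) : poch a 0 = 1 := by simp [poch]

lemma poch_succ (a : ℝ) (n : ℕ) : poch a (n + 1) = poch a n * (a + n) :=
  ascPochhammer_succ_eval n a

lemma poch_pos {a : ℝ} (ha : 0 < a) (n : ℕ) : 0 < poch a n := by
  induction n with
  | zero => simp [poch_zero]
  | succ n ih => rw [poch_succ]; positivity

lemma poch_add_one (a : ℝ) (n : ℕ) : a * poch (a + 1) n = poch a n * (a + n) := by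
  induction n with
  | zero => simp [poch_zero]
  | succ n ih =>
    rw [poch_succ, poch_succ, ← mul_assoc, ih]; push_cast; ring

lemma poch_add (a : ℝ) (r k : ℕ) : poch a (r + k) = poch a r * poch (a + r) k := by
  induction k with
  | zero => simp [poch_zero]
  | succ n ih =>
    rw [← add_assoc, poch_succ, poch_succ, ih]; push_cast; ring

/-- The `k`-th Taylor coefficient of `(1 - x) ^ (-α)`. -/
noncomputable def binCoef (α : ℝ) (k : ℕ) : ℝ := poch α k / k.factorial

lemma binCoef_zero (α : ℝ) : binCoef α 0 = 1 := by simp [binCoef, poch_zero]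

lemma binCoef_nonneg {α : ℝ} (hα : 0 < α) (k : ℕ) : 0 ≤ binCoef α k :=
  div_nonneg (poch_pos hα k).le (by positivity)

lemma succ_mul_binCoef_succ (α : ℝ) (k : ℕ) :
    ((k : ℝ) + 1) * binCoef α (k + 1) = (α + k) * binCoef α k := by
  have : (k.factorial : ℝ) ≠ 0 := by positivity
  rw [binCoef, binCoef, poch_succ, Nat.factorial_succ]
  push_cast
  field_simp

/-- Chu–Vandermonde convolution. -/
lemma sum_antidiagonal_binCoef (α β : ℝ) (N : ℕ) :
    ∑ p ∈ antidiagonal N, binCoef α p.1 * binCoef β p.2 = binCoef (α + β) N := by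
  induction N with
  | zero => simp [binCoef_zero]
  | succ N ih =>
    have hN : ((N : ℝ) + 1) ≠ 0 := by positivity
    apply mul_left_cancel₀ hN
    rw [succ_mul_binCoef_succ, ← ih]
    have h1 : ((N : ℝ) + 1) * ∑ p ∈ antidiagonal (N + 1), binCoef α p.1 * binCoef β p.2
        = ∑ p ∈ antidiagonal (N + 1), (p.1 : ℝ) * binCoef α p.1 * binCoef β p.2
          + ∑ p ∈ antidiagonal (N + 1), binCoef α p.1 * ((p.2 : ℝ) * binCoef β p.2) := by
      rw [Finset.mul_sum, ← Finset.sum_add_distrib]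
      refine Finset.sum_congr rfl fun p hp => ?_
      have : (p.1 : ℝ) + p.2 = N + 1 := by exact_mod_cast Finset.HasAntidiagonal.mem_antidiagonal.mp hp
      rw [← this]; ring
    rw [h1, Finset.Nat.sum_antidiagonal_succ, Finset.Nat.sum_antidiagonal_succ', Finset.mul_sum]
    simp only [Nat.cast_zero, zero_mul, mul_zero, zero_add]
    push_cast
    simp only [succ_mul_binCoef_succ]
    rw [← Finset.sum_add_distrib]
    refine Finset.sum_congr rfl fun p hp => ?_
    have : (p.1 : ℝ) + p.2 = N := by exact_mod_cast Finset.HasAntidiagonal.mem_antidiagonal.mp hp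
    rw [← this]; ring

lemma binCoef_mul_binCoef_add (α : ℝ) (r k : ℕ) :
    binCoef α r * binCoef (α + r) k = (r + k).choose r * binCoef α (r + k) := by
  rw [binCoef, binCoef, binCoef, poch_add, Nat.cast_choose ℝ (Nat.le_add_right r k)]
  have h1 : (r.factorial : ℝ) ≠ 0 := by positivity
  have h2 : (k.factorial : ℝ) ≠ 0 := by positivity
  have h3 : ((r + k).factorial : ℝ) ≠ 0 := by positivity
  rw [Nat.add_sub_cancel_left]
  field_simp

lemma binCoef_half_eq_prod (N : ℕ) :
    binCoef (1 / 2) N = ∏ i ∈ Finset.range N, ((2 * i + 1) / (2 * i + 2) : ℝ) := by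
  induction N with
  | zero => simp [binCoef_zero]
  | succ N ih =>
    have hN : ((N : ℝ) + 1) ≠ 0 := by positivity
    rw [Finset.prod_range_succ, ← ih]
    apply mul_left_cancel₀ hN
    rw [succ_mul_binCoef_succ]
    field_simp
    ring

lemma binCoef_half_eq_doubleFactorial (r : ℕ) :
    ((2 * r - 1).doubleFactorial : ℝ) / ((2 * r).doubleFactorial : ℝ) = binCoef (1 / 2) r := by
  induction r with
  | zero => simp [binCoef_zero]
  | succ r ih =>
    have hN : ((r : ℝ) + 1) ≠ 0 := by positivity
    apply mul_left_cancel₀ hN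
    rw [succ_mul_binCoef_succ, ← ih]
    have h1 : (2 * (r + 1) - 1).doubleFactorial = (2 * r + 1) * (2 * r - 1).doubleFactorial := by
      rcases r with _ | r
      · rfl
      · exact Nat.doubleFactorial_add_two (2 * r + 1)
    have h2 : (2 * (r + 1)).doubleFactorial = (2 * r + 2) * (2 * r).doubleFactorial :=
      Nat.doubleFactorial_add_two (2 * r)
    have h3 : ((2 * r).doubleFactorial : ℝ) ≠ 0 := by
      exact_mod_cast (Nat.doubleFactorial_pos _).ne'
    rw [h1, h2]
    push_cast
    field_simp
    ring

lemma binCoef_half_le_one (r : ℕ) : binCoef (1 / 2) r ≤ 1 := by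
  rw [binCoef_half_eq_prod]
  refine Finset.prod_le_one (fun i _ => by positivity) fun i _ => ?_
  rw [div_le_one (by positivity)]
  linarith

lemma hasSum_binCoef_half {z : ℝ} (h0 : 0 ≤ z) (h1 : z < 1) :
    HasSum (fun l => binCoef (1 / 2) l * z ^ l) (1 / √(1 - z)) := by
  have h := (Real.one_div_one_sub_rpow_hasFPowerSeriesOnBall_zero (1 / 2)).hasSum (y := z) (by
    simp [abs_of_nonneg h0, enorm_eq_nnnorm, ← NNReal.coe_lt_coe, h1])
  simp only [FormalMultilinearSeries.ofScalars_apply_eq, zero_add, smul_eq_mul] at h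
  have hc (l : ℕ) : binCoef (1 / 2) l = Ring.choose ((1 : ℝ) / 2 + l - 1) l := by
    rw [Ring.choose, ← smul_right_inj (Nat.factorial_ne_zero l),
      Ring.factorial_nsmul_multichoose_eq_ascPochhammer, Polynomial.ascPochhammer_smeval_eq_eval,
      binCoef, poch, nsmul_eq_mul, mul_div_cancel₀ _ (by positivity)]
    ring_nf
  simpa only [hc, Real.sqrt_eq_rpow] using h

lemma binCoef_mul_factorial_le (n k : ℕ) :
    binCoef (((n : ℝ) + 1) / 2) k * k.factorial * n.factorial ≤ (2 * k + n).factorial := by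
  rw [binCoef, div_mul_cancel₀ _ (by positivity)]
  induction k with
  | zero => simp [poch_zero]
  | succ k ih =>
    rw [poch_succ, show 2 * (k + 1) + n = (2 * k + n) + 1 + 1 by ring, Nat.factorial_succ,
      Nat.factorial_succ]
    push_cast
    have := (poch_pos (a := ((n : ℝ) + 1) / 2) (by positivity) k)
    calc poch (((n : ℝ) + 1) / 2) k * (((n : ℝ) + 1) / 2 + k) * n.factorial
        = (((n : ℝ) + 1) / 2 + k) * (poch (((n : ℝ) + 1) / 2) k * n.factorial) := by ring
      _ ≤ ((2 * k + n + 1 + 1) * (2 * k + n + 1)) * (2 * k + n).factorial := by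
        gcongr
        have hn : (0 : ℝ) ≤ n := n.cast_nonneg
        have hk : (0 : ℝ) ≤ k := k.cast_nonneg
        nlinarith [hn, hk, mul_nonneg hn hk]
      _ = _ := by ring

/-! ### Locally normally summable families -/

/-- A family of real functions that is normally summable on every bounded interval. -/
def LocallyNormallySummable (f : ℕ → ℝ → ℝ) : Prop :=
  ∀ R : ℝ, 0 ≤ R → ∃ u : ℕ → ℝ, Summable u ∧ ∀ n t, |t| ≤ R → |f n t| ≤ u n

lemma LocallyNormallySummable.summable {f : ℕ → ℝ → ℝ} (hf : LocallyNormallySummable f) (t : ℝ) :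
    Summable fun n => ‖f n t‖ := by
  obtain ⟨u, hu, hb⟩ := hf |t| (abs_nonneg t)
  exact .of_nonneg_of_le (fun n => norm_nonneg _) (fun n => hb n t le_rfl) hu

lemma LocallyNormallySummable.continuous {f : ℕ → ℝ → ℝ} (hf : LocallyNormallySummable f)
    (hc : ∀ n, Continuous (f n)) : Continuous fun t => ∑' n, f n t := by
  rw [continuous_iff_continuousAt]
  intro x
  obtain ⟨u, hu, hb⟩ := hf (|x| + 1) (by positivity)
  refine (continuousOn_tsum (s := Metric.closedBall 0 (|x| + 1))
    (fun n => (hc n).continuousOn) hu fun n t ht => hb n t (by simpa using ht)).continuousAt ?_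
  exact Metric.closedBall_mem_nhds_of_mem (by simp)

/-- Term-by-term convolution of two locally normally summable series. -/
lemma LocallyNormallySummable.hasSum_convolution {u v : ℕ → ℝ → ℝ}
    (hu : LocallyNormallySummable u) (hv : LocallyNormallySummable v)
    (hcu : ∀ n, Continuous (u n)) (hcv : ∀ n, Continuous (v n)) {t : ℝ} (ht : 0 ≤ t) :
    HasSum (fun N => ∑ p ∈ antidiagonal N, ∫ s in 0..t, u p.1 s * v p.2 (t - s))
      (∫ s in 0..t, (∑' n, u n s) * ∑' n, v n (t - s)) := by
  obtain ⟨A, hA, hAb⟩ := hu t ht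
  obtain ⟨B, hB, hBb⟩ := hv t ht
  have hA0 : ∀ n, 0 ≤ A n := fun n => (abs_nonneg _).trans (hAb n 0 (by simpa using ht))
  have hB0 : ∀ n, 0 ≤ B n := fun n => (abs_nonneg _).trans (hBb n 0 (by simpa using ht))
  have hsum : Summable fun N => ∑ p ∈ antidiagonal N, A p.1 * B p.2 := by
    refine (summable_norm_sum_mul_antidiagonal_of_summable_norm (f := A) (g := B) ?_ ?_).of_norm
    · simpa only [Real.norm_of_nonneg (hA0 _)] using hA
    · simpa only [Real.norm_of_nonneg (hB0 _)] using hB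
  have hcont (i j : ℕ) : Continuous fun s => u i s * v j (t - s) :=
    (hcu i).mul ((hcv j).comp (continuous_const.sub continuous_id))
  have key := intervalIntegral.hasSum_integral_of_dominated_convergence (μ := volume)
    (a := 0) (b := t) (F := fun N s => ∑ p ∈ antidiagonal N, u p.1 s * v p.2 (t - s))
    (f := fun s => (∑' n, u n s) * ∑' n, v n (t - s))
    (fun N _ => ∑ p ∈ antidiagonal N, A p.1 * B p.2)
    (fun N => (continuous_finsetSum _ fun p _ => hcont p.1 p.2).aestronglyMeasurable)
    (fun N => .of_forall fun s hs => ?_) (.of_forall fun s hs => hsum) (by simp)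
    (.of_forall fun s hs => ?_)
  · simpa only [intervalIntegral.integral_finsetSum
      (fun (p : ℕ × ℕ) _ => (hcont p.1 p.2).intervalIntegrable 0 t)] using key
  · rw [Set.uIoc_of_le ht] at hs
    refine (norm_sum_le _ _).trans (Finset.sum_le_sum fun p _ => ?_)
    rw [norm_mul]
    exact mul_le_mul (hAb _ _ (by rw [abs_of_pos hs.1]; exact hs.2))
      (hBb _ _ (by rw [abs_of_nonneg (by linarith [hs.2])]; linarith [hs.1]))
      (norm_nonneg _) (hA0 _)
  · rw [tsum_mul_tsum_eq_tsum_sum_antidiagonal_of_summable_norm (hu.summable s)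
      (hv.summable (t - s))]
    exact (summable_norm_sum_mul_antidiagonal_of_summable_norm (hu.summable s)
      (hv.summable (t - s))).of_norm.hasSum

/-- Term-by-term integration of a normally summable series. -/
lemma hasSum_intervalIntegral_of_bound {u : ℕ → ℝ → ℝ} {f : ℝ → ℝ} {A : ℕ → ℝ} {b : ℝ}
    (hb : 0 ≤ b) (hcu : ∀ n, Continuous (u n)) (hA : Summable A)
    (hbound : ∀ n, ∀ s ∈ Set.Ioc 0 b, |u n s| ≤ A n)
    (hf : ∀ s ∈ Set.Ioc 0 b, HasSum (fun n => u n s) (f s)) :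
    HasSum (fun n => ∫ s in 0..b, u n s) (∫ s in 0..b, f s) := by
  rw [← Set.uIoc_of_le hb] at hbound hf
  exact intervalIntegral.hasSum_integral_of_dominated_convergence (fun n _ => A n)
    (fun n => (hcu n).aestronglyMeasurable) (fun n => .of_forall fun s hs => hbound n s hs)
    (.of_forall fun s hs => hA) (by simp) (.of_forall hf)

lemma integral_pow_mul_sub_pow (t : ℝ) (i j : ℕ) :
    ∫ s in 0..t, s ^ i / i.factorial * ((t - s) ^ j / j.factorial)
      = t ^ (i + j + 1) / (i + j + 1).factorial := by
  induction i generalizing j with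
  | zero =>
    simp only [pow_zero, Nat.factorial_zero, Nat.cast_one, div_one, one_mul, zero_add]
    rw [intervalIntegral.integral_div,
      intervalIntegral.integral_comp_sub_left (fun x => x ^ j) t, integral_pow, Nat.factorial_succ]
    push_cast
    simp [div_div]
  | succ i ih =>
    have hi : (i.factorial : ℝ) ≠ 0 := by positivity
    have hj : (j.factorial : ℝ) ≠ 0 := by positivity
    have h := intervalIntegral.integral_mul_deriv_eq_deriv_mul (a := 0) (b := t)
      (u := fun s => s ^ (i + 1) / (i + 1).factorial) (u' := fun s => s ^ i / i.factorial)
      (v := fun s => -((t - s) ^ (j + 1) / (j + 1).factorial))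
      (v' := fun s => (t - s) ^ j / j.factorial)
      (fun s _ => by
        refine ((hasDerivAt_pow (i + 1) s).div_const _).congr_deriv ?_
        rw [Nat.factorial_succ]; push_cast
        field_simp)
      (fun s _ => by
        refine (((((hasDerivAt_id s).const_sub t).pow (j + 1)).div_const _).neg).congr_deriv ?_
        rw [Nat.factorial_succ]; push_cast
        field_simp
        simp)
      (Continuous.intervalIntegrable (by fun_prop) _ _)
      (Continuous.intervalIntegrable (by fun_prop) _ _)
    rw [h]
    simp only [mul_neg, intervalIntegral.integral_neg, ih (j + 1)]
    simp [show i + (j + 1) + 1 = i + 1 + j + 1 by ring]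

/-! ### The functions with Laplace transform `(p ^ 2 + a ^ 2) ^ (-(n + 1) / 2)` -/

/-- Terms of the Taylor series of `besselG`. -/
noncomputable def besselTerm (a : ℝ) (n k : ℕ) (t : ℝ) : ℝ :=
  binCoef (((n : ℝ) + 1) / 2) k * (-a ^ 2) ^ k * (t ^ (2 * k + n) / (2 * k + n).factorial)

/-- The function `√π / Γ((n + 1) / 2) * (t / (2 a)) ^ (n / 2) * J_{n / 2}(a t)`, whose Laplace
transform is `(p ^ 2 + a ^ 2) ^ (-(n + 1) / 2)`. -/
noncomputable def besselG (a : ℝ) (n : ℕ) (t : ℝ) : ℝ := ∑' k, besselTerm a n k t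

lemma continuous_besselTerm (a : ℝ) (n k : ℕ) : Continuous (besselTerm a n k) := by
  unfold besselTerm; fun_prop

lemma abs_besselTerm_le (a : ℝ) (n k : ℕ) {R t : ℝ} (ht : |t| ≤ R) :
    |besselTerm a n k t| ≤ (a ^ 2 * R ^ 2) ^ k / k.factorial * (R ^ n / n.factorial) := by
  have hb := binCoef_nonneg (α := ((n : ℝ) + 1) / 2) (by positivity) k
  have hR : 0 ≤ R := (abs_nonneg t).trans ht
  have h1 : |besselTerm a n k t| = binCoef (((n : ℝ) + 1) / 2) k * (a ^ 2) ^ k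
      * (|t| ^ (2 * k + n) / (2 * k + n).factorial) := by
    rw [besselTerm, abs_mul, abs_mul, abs_pow, abs_neg, abs_div, abs_pow, abs_of_nonneg hb,
      sq_abs, abs_pow, Nat.abs_cast]
  have hfac := binCoef_mul_factorial_le n k
  calc |besselTerm a n k t|
      ≤ binCoef (((n : ℝ) + 1) / 2) k * (a ^ 2) ^ k * (R ^ (2 * k + n) / (2 * k + n).factorial) := by
        rw [h1]; gcongr
    _ = (binCoef (((n : ℝ) + 1) / 2) k / (2 * k + n).factorial) * ((a ^ 2 * R ^ 2) ^ k * R ^ n) := by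
        rw [mul_pow, ← pow_mul R, pow_add]; ring
    _ ≤ (1 / (k.factorial * n.factorial)) * ((a ^ 2 * R ^ 2) ^ k * R ^ n) := by
        gcongr ?_ * _
        rw [div_le_div_iff₀ (by positivity) (by positivity)]
        linarith
    _ = _ := by field_simp

lemma locallyNormallySummable_besselTerm (a : ℝ) (n : ℕ) :
    LocallyNormallySummable (besselTerm a n) := fun R _ =>
  ⟨_, (Real.summable_pow_div_factorial (a ^ 2 * R ^ 2)).mul_right (R ^ n / n.factorial),
    fun k _ ht => abs_besselTerm_le a n k ht⟩

lemma continuous_besselG (a : ℝ) (n : ℕ) : Continuous (besselG a n) :=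
  (locallyNormallySummable_besselTerm a n).continuous (continuous_besselTerm a n)

lemma abs_besselG_le (a : ℝ) (n : ℕ) {R t : ℝ} (ht : |t| ≤ R) :
    |besselG a n t| ≤ Real.exp (a ^ 2 * R ^ 2) * (R ^ n / n.factorial) := by
  have hsum : HasSum (fun k : ℕ => (a ^ 2 * R ^ 2) ^ k / k.factorial * (R ^ n / n.factorial))
      (Real.exp (a ^ 2 * R ^ 2) * (R ^ n / n.factorial)) := by
    rw [Real.exp_eq_exp_ℝ]
    exact (NormedSpace.expSeries_div_hasSum_exp (a ^ 2 * R ^ 2)).mul_right _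
  exact tsum_of_norm_bounded (f := fun k => besselTerm a n k t) hsum fun k => abs_besselTerm_le a n k ht

/-- `besselG a n` is the `(n + 1)`-st convolution power of `besselG a 0`. -/
lemma convolution_besselG (a : ℝ) (n m : ℕ) {t : ℝ} (ht : 0 ≤ t) :
    ∫ s in 0..t, besselG a n s * besselG a m (t - s) = besselG a (n + m + 1) t := by
  have h := (locallyNormallySummable_besselTerm a n).hasSum_convolution
    (locallyNormallySummable_besselTerm a m) (continuous_besselTerm a n)
    (continuous_besselTerm a m) ht
  refine h.tsum_eq.symm.trans (tsum_congr fun N => ?_)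
  have hterm (p : ℕ × ℕ) (hp : p ∈ antidiagonal N) :
      ∫ s in 0..t, besselTerm a n p.1 s * besselTerm a m p.2 (t - s)
        = binCoef (((n : ℝ) + 1) / 2) p.1 * binCoef (((m : ℝ) + 1) / 2) p.2
          * ((-a ^ 2) ^ N * (t ^ (2 * N + (n + m + 1)) / (2 * N + (n + m + 1)).factorial)) := by
    rw [Finset.HasAntidiagonal.mem_antidiagonal] at hp
    subst hp
    rw [show 2 * (p.1 + p.2) + (n + m + 1) = 2 * p.1 + n + (2 * p.2 + m) + 1 by ring,
      ← integral_pow_mul_sub_pow, ← intervalIntegral.integral_const_mul,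
      ← intervalIntegral.integral_const_mul]
    refine intervalIntegral.integral_congr fun s _ => ?_
    simp only [besselTerm, pow_add (-a ^ 2)]
    ring
  rw [Finset.sum_congr rfl hterm, ← Finset.sum_mul, sum_antidiagonal_binCoef, besselTerm]
  push_cast
  ring_nf

lemma poch_mul_Gamma {α : ℝ} (hα : 0 < α) (k : ℕ) :
    poch α k * Real.Gamma α = Real.Gamma (α + k) := by
  induction k with
  | zero => simp [poch_zero]
  | succ k ih =>
    rw [poch_succ, mul_right_comm, ih, Nat.cast_succ, ← add_assoc,
      Real.Gamma_add_one (by positivity), mul_comm]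

lemma besselJ_eq_besselG {a t : ℝ} (ha : 0 < a) (ht : 0 < t) (n : ℕ) :
    √π * (1 / Real.Gamma (((n : ℝ) + 1) / 2) * (t / (2 * a)) ^ ((n : ℝ) / 2)
      * besselJ ((n : ℝ) / 2) (a * t)) = besselG a n t := by
  rw [besselJ, besselG, ← tsum_mul_left, ← tsum_mul_left]
  refine tsum_congr fun k => ?_
  have hα : 0 < ((n : ℝ) + 1) / 2 := by positivity
  have hdup := Real.Gamma_mul_Gamma_add_half (((n : ℝ) + 1) / 2 + k)
  rw [show ((n : ℝ) + 1) / 2 + k + 1 / 2 = k + n / 2 + 1 by ring,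
    show 2 * (((n : ℝ) + 1) / 2 + k) = ((2 * k + n : ℕ) : ℝ) + 1 by push_cast; ring,
    Real.Gamma_nat_eq_factorial, ← poch_mul_Gamma hα,
    show (1 : ℝ) - (((2 * k + n : ℕ) : ℝ) + 1) = -((2 * k + n : ℕ) : ℝ) by ring,
    Real.rpow_neg (by norm_num), Real.rpow_natCast] at hdup
  have hpow : (t / (2 * a)) ^ ((n : ℝ) / 2) * (a * t / 2) ^ (2 * (k : ℝ) + n / 2)
      = a ^ (2 * k) * t ^ (2 * k + n) / 2 ^ (2 * k + n) := by
    rw [Real.rpow_add (by positivity), mul_left_comm,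
      ← Real.mul_rpow (by positivity) (by positivity),
      show t / (2 * a) * (a * t / 2) = (t / 2) ^ 2 by field_simp,
      ← Real.rpow_natCast_mul (by positivity),
      show ((2 : ℕ) : ℝ) * ((n : ℝ) / 2) = n by push_cast; ring,
      show (2 * (k : ℝ)) = ((2 * k : ℕ) : ℝ) by push_cast; ring, Real.rpow_natCast,
      Real.rpow_natCast]
    simp only [div_pow, mul_pow, pow_add]
    field_simp
  have hG : Real.Gamma (((n : ℝ) + 1) / 2) ≠ 0 := (Real.Gamma_pos_of_pos hα).ne'
  have hG' : Real.Gamma ((k : ℝ) + n / 2 + 1) ≠ 0 :=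
    (Real.Gamma_pos_of_pos (by positivity)).ne'
  have hfac : ((2 * k + n).factorial : ℝ) ≠ 0 := by positivity
  have hπ : √π ≠ 0 := by positivity
  calc √π * (1 / Real.Gamma (((n : ℝ) + 1) / 2) * (t / (2 * a)) ^ ((n : ℝ) / 2)
        * ((-1) ^ k / (k.factorial * Real.Gamma ((k : ℝ) + n / 2 + 1))
          * (a * t / 2) ^ (2 * (k : ℝ) + n / 2)))
      = √π * (-1) ^ k / (k.factorial * (Real.Gamma (((n : ℝ) + 1) / 2)
          * Real.Gamma ((k : ℝ) + n / 2 + 1)))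
        * ((t / (2 * a)) ^ ((n : ℝ) / 2) * (a * t / 2) ^ (2 * (k : ℝ) + n / 2)) := by
        field_simp
    _ = poch (((n : ℝ) + 1) / 2) k / k.factorial * (-1) ^ k * a ^ (2 * k)
        * (t ^ (2 * k + n) / (2 * k + n).factorial) := by
        rw [hpow]
        field_simp
        field_simp at hdup
        linear_combination (-1 : ℝ) * hdup
    _ = besselTerm a n k t := by
        rw [besselTerm, binCoef, neg_pow (a ^ 2), ← pow_mul]; ring

lemma locallyNormallySummable_mul_besselG (a : ℝ) {X : ℕ → ℝ} {C : ℝ}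
    (hX : ∀ n, |X n| ≤ C ^ n) :
    LocallyNormallySummable fun n t => X n * besselG a n t := fun R hR => by
  refine ⟨_, (Real.summable_pow_div_factorial (C * R)).mul_left (Real.exp (a ^ 2 * R ^ 2)),
    fun n t ht => ?_⟩
  rw [abs_mul]
  calc |X n| * |besselG a n t|
      ≤ C ^ n * (Real.exp (a ^ 2 * R ^ 2) * (R ^ n / n.factorial)) :=
        mul_le_mul (hX n) (abs_besselG_le a n ht) (abs_nonneg _) ((abs_nonneg _).trans (hX n))
    _ = _ := by rw [mul_pow]; ring

/-- The renewal equation satisfied by the solution of the renewal recursion. -/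
lemma tsum_mul_besselG_eq_convolution (a lam : ℝ) {X Z : ℕ → ℝ} {C D : ℝ}
    (hX : ∀ n, |X n| ≤ C ^ n) (hZ : ∀ n, |Z n| ≤ D ^ n) (h0 : Z 0 = X 0)
    (hrec : ∀ N, Z (N + 1) = X (N + 1) + lam * ∑ p ∈ antidiagonal N, X p.1 * Z p.2)
    {t : ℝ} (ht : 0 ≤ t) :
    ∑' n, Z n * besselG a n t = ∑' n, X n * besselG a n t
      + lam * ∫ s in 0..t, (∑' n, X n * besselG a n s) * ∑' n, Z n * besselG a n (t - s) := by
  have hsX := locallyNormallySummable_mul_besselG a hX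
  have hsZ := locallyNormallySummable_mul_besselG a hZ
  have hconv := hsX.hasSum_convolution hsZ
    (fun n => (continuous_besselG a n).const_mul _) (fun n => (continuous_besselG a n).const_mul _) ht
  have hterm (N : ℕ) : lam * ∑ p ∈ antidiagonal N,
      ∫ s in 0..t, X p.1 * besselG a p.1 s * (Z p.2 * besselG a p.2 (t - s))
      = Z (N + 1) * besselG a (N + 1) t - X (N + 1) * besselG a (N + 1) t := by
    rw [← sub_mul, hrec, add_sub_cancel_left, mul_assoc, Finset.sum_mul]
    congr 1
    refine Finset.sum_congr rfl fun p hp => ?_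
    rw [← Finset.HasAntidiagonal.mem_antidiagonal.mp hp, ← convolution_besselG a _ _ ht,
      ← intervalIntegral.integral_const_mul]
    exact intervalIntegral.integral_congr fun s _ => by ring
  rw [← (hconv.mul_left lam).tsum_eq]
  simp only [hterm]
  have h1 := (hsX.summable t).of_norm
  have h2 := (hsZ.summable t).of_norm
  rw [h1.tsum_eq_zero_add, h2.tsum_eq_zero_add, h0,
    Summable.tsum_sub ((summable_nat_add_iff 1).mpr h2) ((summable_nat_add_iff 1).mpr h1)]
  ring

/-! ### The Bessel function of order zero -/

/-- The Bessel function `J₀`, given by its integral representation. -/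
noncomputable def besselJZero (z : ℝ) : ℝ := (1 / π) * ∫ θ in 0..π, Real.cos (z * Real.sin θ)

lemma continuous_besselJZero : Continuous besselJZero :=
  continuous_const.mul <| intervalIntegral.continuous_parametric_intervalIntegral_of_continuous'
    (by fun_prop) _ _

lemma abs_besselJZero_le (z : ℝ) : |besselJZero z| ≤ 1 := by
  have h := intervalIntegral.norm_integral_le_of_norm_le_const (a := 0) (b := π) (C := 1)
    (f := fun θ => Real.cos (z * Real.sin θ)) fun θ _ => Real.abs_cos_le_one _
  rw [sub_zero, abs_of_pos Real.pi_pos, one_mul, Real.norm_eq_abs] at h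
  rw [besselJZero, abs_mul, abs_of_pos (by positivity : 0 < 1 / π), one_div_mul_eq_div]
  exact (div_le_one Real.pi_pos).mpr h

lemma summable_pow_two_mul_div_factorial (x : ℝ) :
    Summable fun N : ℕ => x ^ (2 * N) / (2 * N).factorial :=
  (Real.summable_pow_div_factorial x).comp_injective (i := fun N : ℕ => 2 * N)
    (mul_right_injective₀ two_ne_zero)

lemma hasSum_besselJZero (z : ℝ) :
    HasSum (fun N => binCoef (1 / 2) N * ((-1) ^ N * z ^ (2 * N) / (2 * N).factorial))
      (besselJZero z) := by
  have h := hasSum_intervalIntegral_of_bound (b := π) Real.pi_pos.le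
    (u := fun N θ => (-1) ^ N * (z * Real.sin θ) ^ (2 * N) / (2 * N).factorial)
    (f := fun θ => Real.cos (z * Real.sin θ)) (fun N => by fun_prop)
    (summable_pow_two_mul_div_factorial |z|) (fun N θ _ => ?_)
    (fun θ _ => Real.hasSum_cos _)
  · refine (h.mul_left (1 / π)).congr_fun fun N => ?_
    simp only [mul_pow, ← mul_assoc, intervalIntegral.integral_div,
      intervalIntegral.integral_const_mul, integral_sin_pow_even, binCoef_half_eq_prod]
    field_simp
  · rw [abs_div, abs_mul, abs_pow, abs_neg, abs_one, one_pow, one_mul, abs_pow, abs_mul,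
      Nat.abs_cast]
    gcongr
    exact mul_le_of_le_one_right (abs_nonneg z) (Real.abs_sin_le_one θ)

lemma integral_cos_pow_even (n : ℕ) :
    ∫ x in 0..π, Real.cos x ^ (2 * n) = π * binCoef (1 / 2) n := by
  induction n with
  | zero => simp [binCoef_zero]
  | succ n ih =>
    rw [mul_add_one, integral_cos_pow, ih, binCoef_half_eq_prod, binCoef_half_eq_prod,
      Finset.prod_range_succ]
    push_cast
    simp
    ring

lemma integral_exp_mul_cos_Ioi {p : ℝ} (hp : 0 < p) (b : ℝ) :
    ∫ t in Set.Ioi (0 : ℝ), Real.exp (-p * t) * Real.cos (b * t) = p / (p ^ 2 + b ^ 2) := by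
  have hre : (-(p : ℂ) + b * Complex.I).re < 0 := by simpa using hp
  have h := congrArg Complex.re (integral_exp_mul_complex_Ioi hre 0)
  rw [← RCLike.re_eq_complex_re, ← integral_re (integrableOn_exp_mul_complex_Ioi hre 0)] at h
  have hne : p ^ 2 + b ^ 2 ≠ 0 := by positivity
  convert h using 1
  · refine integral_congr_ae (.of_forall fun t => ?_)
    simp [Complex.exp_re]
  · simp [Complex.div_re, Complex.normSq_apply]
    field_simp

/-- Fubini for the Laplace transform of a bounded parametric integral. -/
lemma integral_Ioi_exp_mul_intervalIntegral {K : ℝ → ℝ → ℝ}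
    (hK : Continuous (Function.uncurry K)) {b C p : ℝ} (hb : 0 ≤ b) (hp : 0 < p)
    (hbound : ∀ x ∈ Set.Ioc 0 b, ∀ t, |K x t| ≤ C) :
    ∫ t in Set.Ioi (0 : ℝ), Real.exp (-p * t) * ∫ x in 0..b, K x t
      = ∫ x in 0..b, ∫ t in Set.Ioi (0 : ℝ), Real.exp (-p * t) * K x t := by
  simp only [intervalIntegral.integral_of_le hb, ← integral_const_mul]
  refine integral_integral_swap ?_
  have hdom : Integrable (fun z : ℝ × ℝ => Real.exp (-p * z.1) * C)
      ((volume.restrict (Set.Ioi 0)).prod (volume.restrict (Set.Ioc 0 b))) :=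
    Integrable.mul_prod (f := fun t => Real.exp (-p * t)) (g := fun _ => C)
      (integrableOn_exp_mul_Ioi (by linarith) 0) (integrable_const C)
  refine hdom.mono' ?_ ?_
  · refine Continuous.aestronglyMeasurable ?_
    exact (by fun_prop : Continuous fun z : ℝ × ℝ => Real.exp (-p * z.1)).mul
      (hK.comp continuous_swap)
  · rw [Measure.prod_restrict]
    refine (ae_restrict_iff' (measurableSet_Ioi.prod measurableSet_Ioc)).mpr
      (.of_forall fun z hz => ?_)
    simp only [Function.uncurry, norm_mul, Real.norm_eq_abs, Real.abs_exp]
    gcongr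
    exact hbound _ hz.2 _

lemma integral_exp_mul_besselJZero {p : ℝ} (hp : 0 < p) (b : ℝ) :
    ∫ t in Set.Ioi (0 : ℝ), Real.exp (-p * t) * besselJZero (b * t) = 1 / √(p ^ 2 + b ^ 2) := by
  have hS : 0 < p ^ 2 + b ^ 2 := by positivity
  have hz0 : 0 ≤ b ^ 2 / (p ^ 2 + b ^ 2) := by positivity
  have hz1 : b ^ 2 / (p ^ 2 + b ^ 2) < 1 := by
    rw [div_lt_one hS]; nlinarith
  set z := b ^ 2 / (p ^ 2 + b ^ 2) with hz
  have hswap := integral_Ioi_exp_mul_intervalIntegral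
    (K := fun θ t => Real.cos (b * t * Real.sin θ)) (by fun_prop) Real.pi_pos.le hp (C := 1)
    (fun θ _ t => Real.abs_cos_le_one _)
  have hinner (θ : ℝ) : ∫ t in Set.Ioi (0 : ℝ), Real.exp (-p * t) * Real.cos (b * t * Real.sin θ)
      = p / (p ^ 2 + b ^ 2) * (1 - z * Real.cos θ ^ 2)⁻¹ := by
    simp only [fun t => mul_right_comm b t (Real.sin θ)]
    rw [integral_exp_mul_cos_Ioi hp, div_mul_eq_mul_div, ← div_eq_mul_inv, div_div, hz]
    congr 1
    rw [mul_pow, Real.sin_sq]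
    field_simp
    ring
  have hcos (θ : ℝ) : Real.cos θ ^ 2 ≤ 1 := Real.cos_sq_le_one θ
  have hser := hasSum_intervalIntegral_of_bound (b := π) Real.pi_pos.le
    (u := fun l θ => z ^ l * Real.cos θ ^ (2 * l)) (f := fun θ => (1 - z * Real.cos θ ^ 2)⁻¹)
    (fun l => by fun_prop) (summable_geometric_of_lt_one hz0 hz1)
    (fun l θ _ => by
      rw [pow_mul, abs_of_nonneg (by positivity)]
      exact mul_le_of_le_one_right (by positivity) (pow_le_one₀ (sq_nonneg _) (hcos θ)))
    (fun θ _ => by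
      simpa only [mul_pow, pow_mul] using hasSum_geometric_of_lt_one (r := z * Real.cos θ ^ 2)
        (by positivity) ((mul_le_of_le_one_right hz0 (hcos θ)).trans_lt hz1))
  simp only [intervalIntegral.integral_const_mul, integral_cos_pow_even] at hser
  have hval := ((hasSum_binCoef_half hz0 hz1).mul_left π).unique
    (hser.congr_fun fun l => by ring)
  have hroot : √(1 - z) = p / √(p ^ 2 + b ^ 2) := by
    rw [hz, one_sub_div hS.ne', add_sub_cancel_right, Real.sqrt_div (sq_nonneg p),
      Real.sqrt_sq hp.le]
  have hmul : √(p ^ 2 + b ^ 2) ^ 2 = p ^ 2 + b ^ 2 := Real.sq_sqrt hS.le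
  have hroot0 : √(p ^ 2 + b ^ 2) ≠ 0 := by positivity
  calc ∫ t in Set.Ioi (0 : ℝ), Real.exp (-p * t) * besselJZero (b * t)
      = 1 / π * ∫ t in Set.Ioi (0 : ℝ), Real.exp (-p * t) *
          ∫ θ in 0..π, Real.cos (b * t * Real.sin θ) := by
        rw [← integral_const_mul]
        exact integral_congr_ae (.of_forall fun t => by simp only [besselJZero]; ring)
    _ = 1 / √(p ^ 2 + b ^ 2) := by
        rw [hswap]
        simp only [hinner, intervalIntegral.integral_const_mul]
        rw [← hval, hroot]
        field_simp
        exact hmul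

/-- The multiplication theorem for `J₀`. -/
lemma tsum_mul_besselG_eq_besselJZero {a t w : ℝ} (hw : w ^ 2 ≤ 1) :
    ∑' r, binCoef (1 / 2) r * (a * w) ^ (2 * r) * besselG a (2 * r) t
      = besselJZero (a * √(1 - w ^ 2) * t) := by
  set S : ℕ × ℕ → ℝ := fun x =>
    binCoef (1 / 2) x.1 * (a * w) ^ (2 * x.1) * besselTerm a (2 * x.1) x.2 t with hSdef
  have hprod : Summable fun x : ℕ × ℕ => (a * w * |t|) ^ (2 * x.1) / (2 * x.1).factorial
      * ((a ^ 2 * |t| ^ 2) ^ x.2 / x.2.factorial) :=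
    (summable_pow_two_mul_div_factorial (a * w * |t|)).mul_of_nonneg
      (Real.summable_pow_div_factorial (a ^ 2 * |t| ^ 2))
      (fun r => by simp only [pow_mul, Pi.zero_apply]; positivity)
      (fun k => by simp only [Pi.zero_apply]; positivity)
  have hS : Summable S := by
    refine Summable.of_norm_bounded hprod fun x => ?_
    have hsq : 0 ≤ (a * w) ^ (2 * x.1) := by rw [pow_mul]; positivity
    rw [hSdef, norm_mul, norm_mul, Real.norm_of_nonneg hsq,
      Real.norm_of_nonneg (binCoef_nonneg (by norm_num) _), Real.norm_eq_abs]
    calc binCoef (1 / 2) x.1 * (a * w) ^ (2 * x.1) * |besselTerm a (2 * x.1) x.2 t|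
        ≤ 1 * (a * w) ^ (2 * x.1) * ((a ^ 2 * |t| ^ 2) ^ x.2 / x.2.factorial
          * (|t| ^ (2 * x.1) / (2 * x.1).factorial)) := by
          gcongr
          · exact binCoef_half_le_one _
          · exact abs_besselTerm_le a _ _ le_rfl
      _ = _ := by rw [mul_pow (a * w)]; ring
  have hanti (N : ℕ) : ∑ x ∈ antidiagonal N, S x
      = binCoef (1 / 2) N * ((-1) ^ N * (a * √(1 - w ^ 2) * t) ^ (2 * N) / (2 * N).factorial) := by
    have hterm (x : ℕ × ℕ) (hx : x ∈ antidiagonal N) : S x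
        = binCoef (1 / 2) N * (t ^ (2 * N) / (2 * N).factorial)
          * (N.choose x.1 • ((a ^ 2 * w ^ 2) ^ x.1 * (-a ^ 2) ^ x.2)) := by
      rw [Finset.HasAntidiagonal.mem_antidiagonal] at hx
      subst hx
      have hb := binCoef_mul_binCoef_add (1 / 2) x.1 x.2
      simp only [hSdef, besselTerm, nsmul_eq_mul]
      rw [show 2 * x.2 + 2 * x.1 = 2 * (x.1 + x.2) by ring,
        show (((2 * x.1 : ℕ) : ℝ) + 1) / 2 = 1 / 2 + x.1 by push_cast; ring, pow_mul (a * w),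
        mul_pow a w]
      linear_combination ((a ^ 2 * w ^ 2) ^ x.1 * (-a ^ 2) ^ x.2
        * (t ^ (2 * (x.1 + x.2)) / (2 * (x.1 + x.2)).factorial)) * hb
    rw [Finset.sum_congr rfl hterm, ← Finset.mul_sum, ← (Commute.all _ _).add_pow',
      show a ^ 2 * w ^ 2 + -a ^ 2 = -1 * (a ^ 2 * (1 - w ^ 2)) by ring, mul_pow (-1 : ℝ),
      mul_pow _ t, pow_mul (a * _), mul_pow a, Real.sq_sqrt (by linarith)]
    ring
  calc ∑' r, binCoef (1 / 2) r * (a * w) ^ (2 * r) * besselG a (2 * r) t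
      = ∑' r, ∑' k, S (r, k) := tsum_congr fun r => by rw [besselG, ← tsum_mul_left]
    _ = ∑' x, S x := hS.tsum_prod.symm
    _ = ∑' N, ∑ x ∈ antidiagonal N, S x := by
        rw [← Finset.HasAntidiagonal.sigmaAntidiagonalEquivProd.tsum_eq S]
        have hS' : Summable fun y : (n : ℕ) × antidiagonal n =>
          S (Finset.HasAntidiagonal.sigmaAntidiagonalEquivProd y) :=
            Finset.HasAntidiagonal.sigmaAntidiagonalEquivProd.summable_iff.mpr hS
        rw [hS'.tsum_sigma' fun n => (hasSum_fintype _).summable]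
        refine tsum_congr fun N => ?_
        rw [tsum_fintype]
        exact Finset.sum_coe_sort (antidiagonal N) S
    _ = _ := by simp only [hanti]; exact (hasSum_besselJZero _).tsum_eq

lemma integral_zero_one_pow (n : ℕ) : ∫ w in (0 : ℝ)..1, w ^ n = 1 / (n + 1) := by
  simp [integral_pow]

/-- The characteristic function of the uniform law on a sphere in dimension `q + 3`, written as a
mixture of Bessel functions of order zero. -/
noncomputable def sphereCharFun (q : ℕ) (a t : ℝ) : ℝ :=
  ((q : ℝ) + 1) * ∫ w in (0 : ℝ)..1, w ^ q * besselJZero (a * √(1 - w ^ 2) * t)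

lemma continuous_sphereCharFun (q : ℕ) (a : ℝ) : Continuous (sphereCharFun q a) :=
  continuous_const.mul <| intervalIntegral.continuous_parametric_intervalIntegral_of_continuous'
    ((by fun_prop : Continuous fun z : ℝ × ℝ => z.2 ^ q).mul
      (continuous_besselJZero.comp (by fun_prop))) _ _

lemma abs_pow_mul_besselJZero_le {q : ℕ} {w : ℝ} (h0 : 0 ≤ w) (z : ℝ) :
    |w ^ q * besselJZero z| ≤ w ^ q := by
  rw [abs_mul, abs_of_nonneg (pow_nonneg h0 q)]
  exact mul_le_of_le_one_right (pow_nonneg h0 q) (abs_besselJZero_le z)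

lemma abs_sphereCharFun_le (q : ℕ) (a t : ℝ) : |sphereCharFun q a t| ≤ 1 := by
  have h := intervalIntegral.norm_integral_le_of_norm_le (μ := volume) zero_le_one
    (f := fun w => w ^ q * besselJZero (a * √(1 - w ^ 2) * t)) (g := fun w => w ^ q)
    (.of_forall fun w hw => abs_pow_mul_besselJZero_le hw.1.le _)
    ((continuous_pow q).intervalIntegrable 0 1)
  rw [integral_zero_one_pow, Real.norm_eq_abs] at h
  have hq : (0 : ℝ) < q + 1 := by positivity
  rw [sphereCharFun, abs_mul, abs_of_pos hq]
  calc ((q : ℝ) + 1) * _ ≤ (q + 1) * (1 / (q + 1)) := by gcongr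
    _ = 1 := by field_simp

lemma sphereCharFun_eq_tsum (q : ℕ) (a t : ℝ) :
    ∑' r : ℕ, binCoef (1 / 2) r * ((q + 1) / (2 * r + q + 1)) * a ^ (2 * r) * besselG a (2 * r) t
      = sphereCharFun q a t := by
  have hbound (r : ℕ) (w : ℝ) (hw : w ∈ Set.Ioc (0 : ℝ) 1) :
      |binCoef (1 / 2) r * (a * w) ^ (2 * r) * besselG a (2 * r) t|
        ≤ Real.exp (a ^ 2 * |t| ^ 2) * ((a * |t|) ^ (2 * r) / (2 * r).factorial) := by
    have h1 : |(a * w) ^ (2 * r)| ≤ a ^ (2 * r) := by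
      rw [mul_pow, abs_mul, pow_mul a, abs_of_nonneg (by positivity : 0 ≤ (a ^ 2) ^ r), abs_pow,
        abs_of_pos hw.1]
      exact mul_le_of_le_one_right (by positivity) (pow_le_one₀ hw.1.le hw.2)
    rw [abs_mul, abs_mul, abs_of_nonneg (binCoef_nonneg (by norm_num) r)]
    calc binCoef (1 / 2) r * |(a * w) ^ (2 * r)| * |besselG a (2 * r) t|
        ≤ 1 * a ^ (2 * r) * (Real.exp (a ^ 2 * |t| ^ 2) * (|t| ^ (2 * r) / (2 * r).factorial)) := by
          refine mul_le_mul (mul_le_mul (binCoef_half_le_one r) h1 (abs_nonneg _) zero_le_one)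
            (abs_besselG_le a _ le_rfl) (abs_nonneg _) ?_
          rw [pow_mul]; positivity
      _ = _ := by rw [mul_pow]; ring
  have hsumm := (summable_pow_two_mul_div_factorial (a * |t|)).mul_left
    (Real.exp (a ^ 2 * |t| ^ 2))
  have hser := hasSum_intervalIntegral_of_bound zero_le_one
    (u := fun r w => w ^ q * (binCoef (1 / 2) r * (a * w) ^ (2 * r) * besselG a (2 * r) t))
    (f := fun w => w ^ q * besselJZero (a * √(1 - w ^ 2) * t)) (fun r => by fun_prop)
    hsumm
    (fun r w hw => ?_) (fun w hw => ?_)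
  · rw [sphereCharFun, ← hser.tsum_eq, ← tsum_mul_left]
    refine tsum_congr fun r => ?_
    have hint : ∫ w in (0 : ℝ)..1,
        w ^ q * (binCoef (1 / 2) r * (a * w) ^ (2 * r) * besselG a (2 * r) t)
        = binCoef (1 / 2) r * a ^ (2 * r) * besselG a (2 * r) t * (1 / (2 * r + q + 1)) := by
      have := integral_zero_one_pow (2 * r + q)
      push_cast at this
      rw [← this, ← intervalIntegral.integral_const_mul]
      exact intervalIntegral.integral_congr fun w _ => by simp only [pow_add, mul_pow]; ring
    rw [hint]
    ring
  · rw [abs_mul, abs_of_pos (pow_pos hw.1 q)]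
    exact (mul_le_of_le_one_left (abs_nonneg _) (pow_le_one₀ hw.1.le hw.2)).trans (hbound r w hw)
  · have hs : Summable fun r => binCoef (1 / 2) r * (a * w) ^ (2 * r) * besselG a (2 * r) t :=
      Summable.of_norm_bounded hsumm fun r => hbound r w hw
    refine (hs.hasSum_iff.mpr ?_).mul_left (w ^ q)
    exact tsum_mul_besselG_eq_besselJZero (pow_le_one₀ hw.1.le hw.2)

lemma integral_exp_mul_sphereCharFun (q : ℕ) {a p : ℝ} (hp : 0 < p) :
    ∫ t in Set.Ioi (0 : ℝ), Real.exp (-p * t) * sphereCharFun q a t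
      = 1 / √(p ^ 2 + a ^ 2) * hypF (1 / 2) (((q : ℝ) + 1) / 2) (((q : ℝ) + 3) / 2)
          (a ^ 2 / (p ^ 2 + a ^ 2)) := by
  have hS : 0 < p ^ 2 + a ^ 2 := by positivity
  have hz0 : 0 ≤ a ^ 2 / (p ^ 2 + a ^ 2) := by positivity
  have hz1 : a ^ 2 / (p ^ 2 + a ^ 2) < 1 := by
    rw [div_lt_one hS]; nlinarith
  set z := a ^ 2 / (p ^ 2 + a ^ 2) with hz
  have hswap := integral_Ioi_exp_mul_intervalIntegral
    (K := fun w t => w ^ q * besselJZero (a * √(1 - w ^ 2) * t))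
    ((by fun_prop : Continuous fun z : ℝ × ℝ => z.1 ^ q).mul
      (continuous_besselJZero.comp (by fun_prop))) zero_le_one hp (C := 1)
    (fun w hw t => (abs_pow_mul_besselJZero_le hw.1.le _).trans (pow_le_one₀ hw.1.le hw.2))
  have hinner (w : ℝ) (hw : w ∈ Set.Ioc (0 : ℝ) 1) : ∫ t in Set.Ioi (0 : ℝ),
      Real.exp (-p * t) * (w ^ q * besselJZero (a * √(1 - w ^ 2) * t))
      = 1 / √(p ^ 2 + a ^ 2) * (w ^ q * (1 / √(1 - z * w ^ 2))) := by
    have hw2 : w ^ 2 ≤ 1 := pow_le_one₀ hw.1.le hw.2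
    simp only [mul_left_comm _ (w ^ q)]
    rw [integral_const_mul, integral_exp_mul_besselJZero hp, mul_pow, Real.sq_sqrt (by linarith),
      show p ^ 2 + a ^ 2 * (1 - w ^ 2) = (p ^ 2 + a ^ 2) * (1 - z * w ^ 2) by
        rw [hz]; field_simp; ring, Real.sqrt_mul hS.le]
    ring
  have hzw {w : ℝ} (hw : w ∈ Set.Ioc (0 : ℝ) 1) : z * w ^ 2 ≤ z :=
    mul_le_of_le_one_right hz0 (pow_le_one₀ hw.1.le hw.2)
  have hser := hasSum_intervalIntegral_of_bound zero_le_one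
    (u := fun l w => w ^ q * (binCoef (1 / 2) l * (z * w ^ 2) ^ l))
    (f := fun w => w ^ q * (1 / √(1 - z * w ^ 2))) (fun l => by fun_prop)
    (summable_geometric_of_lt_one hz0 hz1)
    (fun l w hw => by
      have hb := binCoef_nonneg (α := 1 / 2) (by norm_num) l
      have hw0 := hw.1.le
      rw [abs_of_nonneg (by positivity)]
      calc w ^ q * (binCoef (1 / 2) l * (z * w ^ 2) ^ l) ≤ 1 * (1 * z ^ l) := by
            gcongr
            · exact pow_le_one₀ hw0 hw.2
            · exact binCoef_half_le_one l
            · exact hzw hw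
        _ = z ^ l := by ring)
    (fun w hw => (hasSum_binCoef_half (by positivity) ((hzw hw).trans_lt hz1)).mul_left _)
  have hhyp : hypF (1 / 2) (((q : ℝ) + 1) / 2) (((q : ℝ) + 3) / 2) z
      = (q + 1) * ∫ w in (0 : ℝ)..1, w ^ q * (1 / √(1 - z * w ^ 2)) := by
    rw [hypF, ← hser.tsum_eq, ← tsum_mul_left]
    refine tsum_congr fun l => ?_
    have hint : ∫ w in (0 : ℝ)..1, w ^ q * (binCoef (1 / 2) l * (z * w ^ 2) ^ l)
        = binCoef (1 / 2) l * z ^ l * (1 / (2 * l + q + 1)) := by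
      have := integral_zero_one_pow (2 * l + q)
      push_cast at this
      rw [← this, ← intervalIntegral.integral_const_mul]
      exact intervalIntegral.integral_congr fun w _ => by
        simp only [pow_add, mul_pow, ← pow_mul]; ring
    have hp1 := poch_add_one (((q : ℝ) + 1) / 2) l
    rw [show ((q : ℝ) + 1) / 2 + 1 = (q + 3) / 2 by ring] at hp1
    have hp2 : poch (((q : ℝ) + 3) / 2) l ≠ 0 := (poch_pos (by positivity) l).ne'
    have hq : (2 : ℝ) * l + q + 1 ≠ 0 := by positivity
    rw [hint, binCoef]
    field_simp
    linear_combination (-2 * z ^ l * poch (1 / 2) l) * hp1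
  calc ∫ t in Set.Ioi (0 : ℝ), Real.exp (-p * t) * sphereCharFun q a t
      = ((q : ℝ) + 1) * ∫ t in Set.Ioi (0 : ℝ), Real.exp (-p * t) *
          ∫ w in (0 : ℝ)..1, w ^ q * besselJZero (a * √(1 - w ^ 2) * t) := by
        rw [← integral_const_mul]
        exact integral_congr_ae (.of_forall fun t => by simp only [sphereCharFun]; ring)
    _ = _ := by
        rw [hswap, hhyp, intervalIntegral.integral_congr_ae (.of_forall fun w hw =>
          hinner w (by rwa [Set.uIoc_of_le zero_le_one] at hw)),
          intervalIntegral.integral_const_mul]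
        ring

/-! ### The renewal equation -/

/-- Grönwall bound for the solution of a renewal equation. -/
lemma abs_le_exp_of_renewal {lam : ℝ} (hlam : 0 < lam) {φ h : ℝ → ℝ}
    (hh : Continuous h) (hφ1 : ∀ t, |φ t| ≤ 1)
    (heq : ∀ t, 0 ≤ t → h t = φ t + lam * ∫ s in 0..t, φ s * h (t - s)) {t : ℝ} (ht : 0 ≤ t) :
    |h t| ≤ Real.exp (lam * t) := by
  set G : ℝ → ℝ := fun t => ∫ s in 0..t, |h s| with hG
  have hderiv (x : ℝ) : HasDerivAt G |h x| x :=
    intervalIntegral.integral_hasDerivAt_right (hh.abs.intervalIntegrable _ _)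
      (hh.abs.stronglyMeasurableAtFilter _ _) hh.abs.continuousAt
  have hG0 (x : ℝ) (hx : 0 ≤ x) : 0 ≤ G x :=
    intervalIntegral.integral_nonneg hx fun _ _ => abs_nonneg _
  have hbound (x : ℝ) (hx : 0 ≤ x) : |h x| ≤ lam * G x + 1 := by
    have h1 : |∫ s in 0..x, φ s * h (x - s)| ≤ G x := by
      have h2 : G x = ∫ s in 0..x, |h (x - s)| := by
        rw [intervalIntegral.integral_comp_sub_left (fun s => |h s|)]
        simp [hG]
      rw [h2, ← Real.norm_eq_abs]
      refine intervalIntegral.norm_integral_le_of_norm_le hx (ae_of_all _ fun s _ => ?_)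
        ((hh.comp (continuous_const.sub continuous_id)).abs.intervalIntegrable _ _)
      rw [norm_mul]
      exact mul_le_of_le_one_left (norm_nonneg _) (hφ1 s)
    rw [heq x hx]
    calc _ ≤ |φ x| + |lam * ∫ s in 0..x, φ s * h (x - s)| := abs_add_le _ _
      _ ≤ 1 + lam * G x := by
        rw [abs_mul, abs_of_pos hlam]
        gcongr
        exact hφ1 x
      _ = _ := add_comm _ _
  have key := norm_le_gronwallBound_of_norm_deriv_right_le (f := G) (f' := fun x => |h x|)
    (δ := 0) (K := lam) (ε := 1) (a := 0) (b := t)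
    (fun x _ => (hderiv x).continuousAt.continuousWithinAt)
    (fun x _ => (hderiv x).hasDerivWithinAt) (by simp [hG])
    (fun x hx => by
      rw [Real.norm_eq_abs, Real.norm_eq_abs, abs_abs, abs_of_nonneg (hG0 x hx.1)]
      exact hbound x hx.1) t (Set.right_mem_Icc.2 ht)
  rw [gronwallBound_of_K_ne_0 hlam.ne', Real.norm_eq_abs, abs_of_nonneg (hG0 t ht)] at key
  refine (hbound t ht).trans ?_
  have : lam * G t ≤ Real.exp (lam * t) - 1 := by
    calc lam * G t ≤ lam * (0 * Real.exp (lam * (t - 0))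
          + 1 / lam * (Real.exp (lam * (t - 0)) - 1)) := by gcongr
      _ = _ := by field_simp; simp
  linarith

lemma integrableOn_exp_mul_of_abs_le {p b : ℝ} (hp : b < p) {f : ℝ → ℝ} (hf : Continuous f)
    (hfb : ∀ t, 0 < t → |f t| ≤ Real.exp (b * t)) :
    IntegrableOn (fun t => Real.exp (-p * t) * f t) (Set.Ioi 0) := by
  refine (integrableOn_exp_mul_Ioi (sub_neg.2 hp) 0).mono'
    (by fun_prop : Continuous fun t => Real.exp (-p * t) * f t).aestronglyMeasurable
    ((ae_restrict_iff' measurableSet_Ioi).2 (ae_of_all _ fun t ht => ?_))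
  rw [norm_mul, Real.norm_of_nonneg (Real.exp_pos _).le, Real.norm_eq_abs]
  calc _ ≤ Real.exp (-p * t) * Real.exp (b * t) := by gcongr; exact hfb t ht
    _ = _ := by rw [← Real.exp_add]; ring_nf

/-- Laplace transform of the solution of a renewal equation. -/
lemma integral_exp_mul_of_renewal {lam p : ℝ} (hlam : 0 < lam) (hp : lam < p) {φ h : ℝ → ℝ}
    (hφ : Continuous φ) (hh : Continuous h) (hφ1 : ∀ t, |φ t| ≤ 1)
    (heq : ∀ t, 0 ≤ t → h t = φ t + lam * ∫ s in 0..t, φ s * h (t - s)) :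
    ∫ t in Set.Ioi 0, Real.exp (-p * t) * h t
      = (∫ t in Set.Ioi 0, Real.exp (-p * t) * φ t)
        / (1 - lam * ∫ t in Set.Ioi 0, Real.exp (-p * t) * φ t) := by
  have hp0 : 0 < p := hlam.trans hp
  have hIφ := integrableOn_exp_mul_of_abs_le hp0 hφ fun t _ => by simpa using hφ1 t
  have hIh := integrableOn_exp_mul_of_abs_le hp hh fun t ht =>
    abs_le_exp_of_renewal hlam hh hφ1 heq ht.le
  have hconv := integral_posConvolution (μ := volume) (ν := volume) hIφ hIh
    (ContinuousLinearMap.mul ℝ ℝ)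
  set A := ∫ t in Set.Ioi 0, Real.exp (-p * t) * φ t with hA
  set B := ∫ t in Set.Ioi 0, Real.exp (-p * t) * h t with hB
  have hsub : B - A = lam * (A * B) := by
    rw [ContinuousLinearMap.mul_apply'] at hconv
    rw [hA, hB, ← integral_sub hIh hIφ, ← hA, ← hB, ← hconv, ← integral_const_mul]
    refine setIntegral_congr_fun measurableSet_Ioi fun t ht => ?_
    have : ∫ s in 0..t, Real.exp (-p * s) * φ s * (Real.exp (-p * (t - s)) * h (t - s))
        = Real.exp (-p * t) * ∫ s in 0..t, φ s * h (t - s) := by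
      rw [← intervalIntegral.integral_const_mul]
      refine intervalIntegral.integral_congr fun s _ => ?_
      have : Real.exp (-p * t) = Real.exp (-p * s) * Real.exp (-p * (t - s)) := by
        rw [← Real.exp_add]; ring_nf
      simp only [this]; ring
    simp only [ContinuousLinearMap.mul_apply', this, heq t (le_of_lt ht)]
    ring
  have hAle : A ≤ 1 / p := by
    calc A ≤ ∫ t in Set.Ioi 0, Real.exp (-p * t) := by
          refine setIntegral_mono hIφ (integrableOn_exp_mul_Ioi (neg_neg_of_pos hp0) 0) fun t => ?_
          exact mul_le_of_le_one_right (Real.exp_pos _).le ((le_abs_self _).trans (hφ1 t))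
      _ = _ := by rw [integral_exp_mul_Ioi (neg_neg_of_pos hp0)]; simp
  have hpos : 0 < 1 - lam * A := by
    have : lam * A ≤ lam * (1 / p) := by gcongr
    have h2 : lam * (1 / p) < 1 := by rw [mul_one_div, div_lt_one hp0]; exact hp
    linarith
  rw [eq_div_iff hpos.ne']
  linear_combination hsub

/-! ### The coefficient sequence -/

lemma geom_renewal (a lam : ℝ) (N : ℕ) :
    a ^ (N + 1) + lam * ∑ p ∈ antidiagonal N, a ^ p.1 * (a + lam) ^ p.2 = (a + lam) ^ (N + 1) := by
  have h := (Commute.all (a + lam) a).geom_sum₂_mul (N + 1)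
  rw [Finset.Nat.sum_antidiagonal_eq_sum_range_succ (fun i j => a ^ i * (a + lam) ^ j),
    ← Finset.sum_range_reflect]
  rw [add_sub_cancel_left] at h
  have : ∑ j ∈ Finset.range (N + 1), a ^ (N + 1 - 1 - j) * (a + lam) ^ (N - (N + 1 - 1 - j))
      = ∑ i ∈ Finset.range (N + 1), (a + lam) ^ i * a ^ (N + 1 - 1 - i) :=
    Finset.sum_congr rfl fun i hi => by
      rw [mul_comm]; congr 2; have := Finset.mem_range.1 hi; omega
  rw [this]
  linear_combination h

lemma abs_le_pow_of_renewal {a lam : ℝ} (ha : 0 ≤ a) (hlam : 0 ≤ lam) {X Z : ℕ → ℝ}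
    (hX : ∀ n, |X n| ≤ a ^ n) (h0 : Z 0 = X 0)
    (hrec : ∀ N, Z (N + 1) = X (N + 1) + lam * ∑ p ∈ antidiagonal N, X p.1 * Z p.2) (n : ℕ) :
    |Z n| ≤ (a + lam) ^ n := by
  induction n using Nat.strong_induction_on with
  | _ n ih =>
    cases n with
    | zero => simpa [h0] using hX 0
    | succ N =>
      rw [hrec, ← geom_renewal]
      refine (abs_add_le _ _).trans (add_le_add (hX _) ?_)
      rw [abs_mul, abs_of_nonneg hlam]
      refine mul_le_mul_of_nonneg_left ((Finset.abs_sum_le_sum_abs _ _).trans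
        (Finset.sum_le_sum fun p hp => ?_)) hlam
      rw [abs_mul]
      have hp2 := Finset.HasAntidiagonal.mem_antidiagonal.1 hp
      exact mul_le_mul (hX _) (ih _ (by omega)) (abs_nonneg _) (by positivity)

end

/-- Theorem 1: the Laplace transform of the Bessel-series representation
`H(t) = e^{-λt} √π ∑_{n≥1} ζ_n/Γ(n/2) (t/(2a))^{(n-1)/2} J_{(n-1)/2}(at)`
(here written with the index shift `n ↦ n+1`, summing over `n : ℕ`) equals the known
Fourier–Laplace transform of the `m`-dimensional symmetric Markov random flight. -/
theorem stmt6 (m : ℕ) (hm : 3 ≤ m) (c lam a : ℝ) (hc : 0 < c) (hlam : 0 < lam)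
    (ha : 0 < a) (ξ ζ : ℕ → ℝ)
    (hξeven : ∀ r : ℕ, ξ (2 * r) = 0)
    (hξodd : ∀ r : ℕ, ξ (2 * r + 1)
      = ((2 * r - 1).doubleFactorial : ℝ) / ((2 * r).doubleFactorial : ℝ)
        * (((m : ℝ) - 2) / (2 * (r : ℝ) + (m : ℝ) - 2)) * a ^ (2 * r))
    (hζ1 : ζ 1 = 1)
    (hζ : ∀ n : ℕ, 2 ≤ n →
      ζ n = ξ n + lam * ∑ k ∈ Finset.Icc 1 (n - 1), ζ (n - k) * ξ k)
    (H : ℝ → ℝ)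
    (hH : ∀ t : ℝ, 0 < t →
      H t = Real.exp (-lam * t) * Real.sqrt Real.pi *
        ∑' n : ℕ, ζ (n + 1) / Real.Gamma (((n : ℝ) + 1) / 2)
          * (t / (2 * a)) ^ ((n : ℝ) / 2) * besselJ ((n : ℝ) / 2) (a * t)) :
    ∀ s : ℝ, 0 < s →
      ∫ t in Set.Ioi (0 : ℝ), Real.exp (-s * t) * H t
        = hypF (1 / 2) (((m : ℝ) - 2) / 2) ((m : ℝ) / 2) (a ^ 2 / ((s + lam) ^ 2 + a ^ 2))
          / (Real.sqrt ((s + lam) ^ 2 + a ^ 2)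
              - lam * hypF (1 / 2) (((m : ℝ) - 2) / 2) ((m : ℝ) / 2)
                  (a ^ 2 / ((s + lam) ^ 2 + a ^ 2))) := by
  intro s hs
  obtain ⟨q, rfl⟩ : ∃ q, m = q + 3 := ⟨m - 3, by omega⟩
  set X : ℕ → ℝ := fun n => ξ (n + 1) with hXdef
  set Z : ℕ → ℝ := fun n => ζ (n + 1) with hZdef
  have hXe (r : ℕ) : X (2 * r)
      = binCoef (1 / 2) r * (((q : ℝ) + 1) / (2 * r + q + 1)) * a ^ (2 * r) := by
    rw [hXdef]
    simp only [hξodd, binCoef_half_eq_doubleFactorial]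
    push_cast
    ring_nf
  have hXo (r : ℕ) : X (2 * r + 1) = 0 := hξeven (r + 1)
  have hX (n : ℕ) : |X n| ≤ a ^ n := by
    obtain ⟨r, rfl | rfl⟩ := n.even_or_odd'
    · have h1 := binCoef_nonneg (α := 1 / 2) (by norm_num) r
      have h2 : ((q : ℝ) + 1) / (2 * r + q + 1) ≤ 1 := by
        rw [div_le_one (by positivity)]
        have : (0 : ℝ) ≤ r := r.cast_nonneg
        linarith
      rw [hXe, abs_of_nonneg (by positivity)]
      exact mul_le_of_le_one_left (by positivity)
        (mul_le_one₀ (binCoef_half_le_one r) (by positivity) h2)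
    · rw [hXo, abs_zero]
      positivity
  have h0 : Z 0 = X 0 := by
    have := hXe 0
    have hq : (q : ℝ) + 1 ≠ 0 := by positivity
    simp [binCoef_zero, hq] at this
    rw [this]
    exact hζ1
  have hrec (N : ℕ) : Z (N + 1) = X (N + 1)
      + lam * ∑ p ∈ Finset.HasAntidiagonal.antidiagonal N, X p.1 * Z p.2 := by
    rw [Finset.Nat.sum_antidiagonal_eq_sum_range_succ (fun i j => X i * Z j)]
    simp only [hXdef, hZdef]
    rw [hζ _ (by omega)]
    congr 2
    rw [← Finset.Ico_add_one_right_eq_Icc, Finset.sum_Ico_eq_sum_range]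
    refine Finset.sum_congr (by congr 1) fun i hi => ?_
    have := Finset.mem_range.1 hi
    rw [mul_comm]
    congr 2 <;> omega
  have hZ := abs_le_pow_of_renewal ha.le hlam.le hX h0 hrec
  set h : ℝ → ℝ := fun t => ∑' n, Z n * besselG a n t with hh
  have hφ (t : ℝ) : ∑' n, X n * besselG a n t = sphereCharFun q a t := by
    rw [← sphereCharFun_eq_tsum]
    simp only [← hXe]
    refine ((mul_right_injective₀ (two_ne_zero (α := ℕ))).tsum_eq fun n hn => ?_).symm
    obtain ⟨r, rfl | rfl⟩ := n.even_or_odd'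
    · exact ⟨r, rfl⟩
    · simp [hXo] at hn
  have heq (t : ℝ) (ht : 0 ≤ t) : h t = sphereCharFun q a t
      + lam * ∫ s in 0..t, sphereCharFun q a s * h (t - s) := by
    simpa only [hφ] using tsum_mul_besselG_eq_convolution a lam hX hZ h0 hrec ht
  have hcont : Continuous h := (locallyNormallySummable_mul_besselG a hZ).continuous
    fun n => (continuous_besselG a n).const_mul _
  have hHh (t : ℝ) (ht : 0 < t) : H t = Real.exp (-lam * t) * h t := by
    rw [hH t ht, mul_assoc, ← tsum_mul_left]
    congr 1
    refine tsum_congr fun n => ?_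
    rw [← besselJ_eq_besselG ha ht]
    ring
  have hp : 0 < s + lam := by positivity
  have hint : ∫ t in Set.Ioi 0, Real.exp (-s * t) * H t
      = ∫ t in Set.Ioi 0, Real.exp (-(s + lam) * t) * h t := by
    refine MeasureTheory.setIntegral_congr_fun measurableSet_Ioi fun t ht => ?_
    simp only [hHh t ht, ← mul_assoc, ← Real.exp_add]
    ring_nf
  rw [hint, integral_exp_mul_of_renewal hlam (by linarith) (continuous_sphereCharFun q a) hcont
    (abs_sphereCharFun_le q a) heq, integral_exp_mul_sphereCharFun q hp]
  have e1 : (((q + 3 : ℕ) : ℝ) - 2) / 2 = ((q : ℝ) + 1) / 2 := by push_cast; ring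
  have e2 : (((q + 3 : ℕ) : ℝ)) / 2 = ((q : ℝ) + 3) / 2 := by push_cast; ring
  rw [e1, e2]
  have hr : 0 < √((s + lam) ^ 2 + a ^ 2) := by positivity
  rw [one_div, inv_mul_eq_div, ← mul_div_assoc, one_sub_div hr.ne', div_div_div_cancel_right₀ hr.ne']
end

section
/- (Theorem 3, first part) Let $m=3$, $c>0$, $\lambda>0$. For $\boldsymbol\alpha\in\mathbb{R}^3$ let $\theta_n(\boldsymbol\alpha)$ be given by $\theta_{2r}=0$ and $\theta_{2r+1}=(-1)^r\frac{(1/2)_r}{(3/2)_r}(c\Vert\boldsymbol\alpha\Vert)^{2r}$, let $\gamma_n(\boldsymbol\alpha)$ be defined by $\gamma_1=1$, $\gamma_n=\theta_n+\lambda\sum_{k=1}^{n-1}\gamma_{n-k}\theta_k$, and define $H(\boldsymbol\alpha,t)=e^{-\lambda t}\sum_{n=0}^{\infty}\frac{\gamma_{n+1}(\boldsymbol\alpha)}{n!}t^{n}$. Then for every fixed $t>0$, the mixed partial derivative $\dfrac{\partial^3 H(\boldsymbol\alpha,t)}{\partial\alpha_1\,\partial\alpha_2\,\partial\alpha_3}\Big|_{\alpha_1=\alpha_2=\alpha_3=0}=0$;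 consequently, the first mixed moment $\mu_{(1,1,1)}(t)=\mathbb{E}\,X_1(t)X_2(t)X_3(t)$ of the three-dimensional symmetric Markov random flight is identically zero. -/
/-- Partial derivative of a function on `ℝ³` (as `Fin 3 → ℝ`) in the `i`-th coordinate. -/
noncomputable def pd (i : Fin 3) (f : (Fin 3 → ℝ) → ℝ) : (Fin 3 → ℝ) → ℝ :=
  fun x => deriv (fun u : ℝ => f (Function.update x i u)) (x i)

/-- Partial differentiation in one coordinate preserves evenness in another coordinate. -/
lemma pd_update_neg {i j : Fin 3} (hij : i ≠ j) {f : (Fin 3 → ℝ) → ℝ}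
    (hf : ∀ x, f (Function.update x j (-x j)) = f x) (x : Fin 3 → ℝ) :
    pd i f (Function.update x j (-x j)) = pd i f x := by
  unfold pd
  rw [Function.update_of_ne hij]
  congr 1
  ext u
  rw [Function.update_comm hij.symm]
  simpa [Function.update_of_ne hij.symm] using hf (Function.update x i u)

/-- The partial derivative of a function even in a coordinate vanishes where it is zero. -/
lemma pd_eq_zero_of_even {j : Fin 3} {f : (Fin 3 → ℝ) → ℝ}
    (hf : ∀ x, f (Function.update x j (-x j)) = f x) {x : Fin 3 → ℝ} (hx : x j = 0) :
    pd j f x = 0 := by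
  have heven : (fun u : ℝ => f (Function.update x j (-u))) =
      fun u => f (Function.update x j u) := by
    ext u
    simpa using hf (Function.update x j u)
  have h := deriv_comp_neg (fun u : ℝ => f (Function.update x j u)) 0
  rw [heven, neg_zero] at h
  unfold pd
  rw [hx]
  linarith

/-- Sequences obeying the same convolution recursion agree where their data agree. -/
lemma eq_of_convolution_recursion {X : Type*} {lam : ℝ} {θ γ : ℕ → X → ℝ}
    (hγ1 : ∀ x, γ 1 x = 1)
    (hγ : ∀ n : ℕ, 2 ≤ n → ∀ x,
      γ n x = θ n x + lam * ∑ k ∈ Finset.Icc 1 (n - 1), γ (n - k) x * θ k x)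
    {x y : X} (hθ : ∀ n, θ n x = θ n y) (n : ℕ) (hn : 1 ≤ n) : γ n x = γ n y := by
  induction n using Nat.strong_induction_on with
  | _ n ih =>
    obtain rfl | hn2 := hn.eq_or_lt
    · rw [hγ1, hγ1]
    · rw [hγ n hn2, hγ n hn2, hθ]
      congr 2
      refine Finset.sum_congr rfl fun k hk => ?_
      rw [Finset.mem_Icc] at hk
      rw [hθ, ih (n - k) (by omega) (by omega)]

/-- Theorem 3, first part: the mixed partial derivative
`∂³H/∂α₁∂α₂∂α₃` of the characteristic function of the 3-dimensional symmetric Markov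
random flight vanishes at `α = 0`; hence the first mixed moment
`μ_{(1,1,1)}(t) = (-i)³ ∂³H/∂α₁∂α₂∂α₃ |_{α=0}` is identically zero. -/
theorem stmt13 (c lam : ℝ) (hc : 0 < c) (hlam : 0 < lam)
    (θ γ : ℕ → (Fin 3 → ℝ) → ℝ)
    (hθeven : ∀ (r : ℕ) (α : Fin 3 → ℝ), θ (2 * r) α = 0)
    (hθodd : ∀ (r : ℕ) (α : Fin 3 → ℝ), θ (2 * r + 1) α
      = (-1 : ℝ) ^ r * poch (1 / 2) r / poch (3 / 2) r
          * (c * Real.sqrt (∑ i, α i ^ 2)) ^ (2 * r))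
    (hγ1 : ∀ α : Fin 3 → ℝ, γ 1 α = 1)
    (hγ : ∀ n : ℕ, 2 ≤ n → ∀ α : Fin 3 → ℝ,
      γ n α = θ n α + lam * ∑ k ∈ Finset.Icc 1 (n - 1), γ (n - k) α * θ k α)
    (H : (Fin 3 → ℝ) → ℝ → ℝ)
    (hH : ∀ (α : Fin 3 → ℝ) (t : ℝ),
      H α t = Real.exp (-lam * t) * ∑' n : ℕ, γ (n + 1) α / n.factorial * t ^ n) :
    ∀ t : ℝ, 0 < t →
      pd 0 (pd 1 (pd 2 (fun α => H α t))) (fun _ => 0) = 0 ∧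
      (-Complex.I) ^ 3 * ((pd 0 (pd 1 (pd 2 (fun α => H α t))) (fun _ => 0) : ℝ) : ℂ)
        = 0 := by
  intro t _
  have hθ : ∀ (α : Fin 3 → ℝ) (n : ℕ), θ n (Function.update α 0 (-α 0)) = θ n α := by
    intro α n
    obtain ⟨r, rfl | rfl⟩ := n.even_or_odd'
    · rw [hθeven, hθeven]
    · rw [hθodd, hθodd]
      simp [Fin.sum_univ_three]
  have hHeven : ∀ α : Fin 3 → ℝ, H (Function.update α 0 (-α 0)) t = H α t := by
    intro α
    rw [hH, hH]
    congr 2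
    ext n
    rw [eq_of_convolution_recursion hγ1 hγ (hθ α) (n + 1) (by omega)]
  have hzero : pd 0 (pd 1 (pd 2 (fun α => H α t))) (fun _ => 0) = 0 :=
    pd_eq_zero_of_even
      (pd_update_neg (by decide) (pd_update_neg (by decide) hHeven)) rfl
  exact ⟨hzero, by rw [hzero]; simp⟩
end

section
/- (Theorem 3, second part) Let $m=3$, $c>0$, $\lambda>0$, and let $H(\boldsymbol\alpha,t)=e^{-\lambda t}\sum_{n=0}^{\infty}\frac{\gamma_{n+1}(\boldsymbol\alpha)}{n!}t^{n}$, where $\gamma_1=1$, $\gamma_n=\theta_n+\lambda\sum_{k=1}^{n-1}\gamma_{n-k}\theta_k$ with $\theta_{2r}=0$, $\theta_{2r+1}=(-1)^r\frac{(1/2)_r}{(3/2)_r}(c\Vert\boldsymbol\alpha\Vert)^{2r}$. Then the second mixed moment $\mu_{(2,2,2)}(t)=(-i)^6\,\dfrac{\partial^{6}H(\boldsymbol\alpha,t)}{\partial\alpha_1^{2}\partial\alpha_2^{2}\partial\alpha_3^{2}}\Big|_{\boldsymbol\alpha=0}$ satisfies, as $t\to 0^+$, the asymptotic relation $\mu_{(2,2,2)}(t)=e^{-\lambda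 t}\left[\frac{1}{105}(ct)^6+\lambda\,\frac{44}{11025}\,c^6 t^7\right]+o(t^7)$. -/
open Polynomial in
/-- The monomial in `s = ‖α‖²` that represents `θ (n + 1)`. -/
noncomputable def thetaPoly (c : ℝ) (n : ℕ) : ℝ[X] :=
  monomial (n / 2) (if Even n then (-1) ^ (n / 2) / (n + 1) * c ^ n else 0)

open Polynomial in
/-- The polynomial in `s = ‖α‖²` that represents `γ (n + 1)`. -/
noncomputable def gammaPoly (c lam : ℝ) (n : ℕ) : ℝ[X] :=
  thetaPoly c n + C lam * ∑ k : Fin n, gammaPoly c lam (n - 1 - k) * thetaPoly c k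
decreasing_by have := k.2; omega

open Polynomial in
theorem gammaPoly_eq (c lam : ℝ) (n : ℕ) :
    gammaPoly c lam n = thetaPoly c n +
      C lam * ∑ k ∈ Finset.range n, gammaPoly c lam (n - 1 - k) * thetaPoly c k := by
  rw [gammaPoly, Finset.sum_range]

theorem poch_half_div (r : ℕ) : poch (1 / 2) r / poch (3 / 2) r = 1 / (2 * r + 1) := by
  have pos : ∀ r : ℕ, 0 < poch (3 / 2) r := fun r => ascPochhammer_pos r _ (by norm_num)
  have succ : ∀ (a : ℝ) (r : ℕ), poch a (r + 1) = poch a r * (a + r) := by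
    intro a r
    simp [poch, ascPochhammer_succ_right]
  have key : ∀ r : ℕ, poch (1 / 2) r * (2 * r + 1) = poch (3 / 2) r := by
    intro r
    induction r with
    | zero => simp [poch]
    | succ r ih =>
      rw [succ, succ, ← ih]
      push_cast
      ring
  rw [div_eq_div_iff (pos r).ne' (by positivity), key]
  ring

theorem abs_thetaPoly_coeff_le {c : ℝ} (hc : 0 ≤ c) (n m : ℕ) :
    |(thetaPoly c n).coeff m| ≤ c ^ n := by
  rw [thetaPoly, Polynomial.coeff_monomial]
  have hcn : 0 ≤ c ^ n := by positivity
  split_ifs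
  · rw [abs_mul, abs_div, abs_pow, abs_neg, abs_one, one_pow, abs_of_nonneg hcn,
      abs_of_nonneg (by positivity : (0 : ℝ) ≤ n + 1)]
    exact mul_le_of_le_one_left hcn (by rw [div_le_one (by positivity)]; simp)
  · simpa using hcn
  · simpa using hcn

theorem coeff_mul_thetaPoly (c : ℝ) (p : Polynomial ℝ) (k m : ℕ) :
    (p * thetaPoly c k).coeff m =
      if k / 2 ≤ m then p.coeff (m - k / 2) * (thetaPoly c k).coeff (k / 2) else 0 := by
  rw [thetaPoly, Polynomial.coeff_monomial_same, ← Polynomial.C_mul_X_pow_eq_monomial,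
    ← mul_assoc, Polynomial.coeff_mul_X_pow', Polynomial.coeff_mul_C]

theorem abs_coeff_mul_thetaPoly_le {c B : ℝ} (hc : 0 ≤ c) (hB : 0 ≤ B) (p : Polynomial ℝ)
    (hp : ∀ m, |p.coeff m| ≤ B) (k m : ℕ) :
    |(p * thetaPoly c k).coeff m| ≤ B * c ^ k := by
  rw [coeff_mul_thetaPoly]
  split_ifs with h
  · rw [abs_mul]
    exact mul_le_mul (hp _) (abs_thetaPoly_coeff_le hc k (k / 2)) (abs_nonneg _) hB
  · rw [abs_zero]
    positivity

theorem abs_gammaPoly_coeff_le {c lam : ℝ} (hc : 0 ≤ c) (hlam : 0 ≤ lam) (n m : ℕ) :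
    |(gammaPoly c lam n).coeff m| ≤ (c + lam) ^ n := by
  induction n using Nat.strong_induction_on generalizing m with
  | _ n ih =>
    rw [gammaPoly_eq, Polynomial.coeff_add, Polynomial.coeff_C_mul, Polynomial.finsetSum_coeff]
    have hsum : |∑ k ∈ Finset.range n,
        (gammaPoly c lam (n - 1 - k) * thetaPoly c k).coeff m| ≤
        ∑ k ∈ Finset.range n, c ^ k * (c + lam) ^ (n - 1 - k) := by
      refine (Finset.abs_sum_le_sum_abs _ _).trans (Finset.sum_le_sum fun k hk => ?_)
      rw [mul_comm (c ^ k)]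
      refine abs_coeff_mul_thetaPoly_le hc (by positivity) _ (fun m => ih _ ?_ m) k m
      have := Finset.mem_range.1 hk
      omega
    have hgeom := geom_sum₂_mul c (c + lam) n
    calc _ ≤ |(thetaPoly c n).coeff m| + |lam * ∑ k ∈ Finset.range n,
        (gammaPoly c lam (n - 1 - k) * thetaPoly c k).coeff m| := abs_add_le _ _
      _ ≤ c ^ n + lam * ∑ k ∈ Finset.range n, c ^ k * (c + lam) ^ (n - 1 - k) := by
        rw [abs_mul, abs_of_nonneg hlam]
        gcongr
        exact abs_thetaPoly_coeff_le hc n m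
      _ = (c + lam) ^ n := by linarith

theorem natDegree_thetaPoly_le (c : ℝ) (n : ℕ) : (thetaPoly c n).natDegree ≤ n / 2 :=
  Polynomial.natDegree_monomial_le _

theorem natDegree_gammaPoly_le (c lam : ℝ) (n : ℕ) : (gammaPoly c lam n).natDegree ≤ n / 2 := by
  induction n using Nat.strong_induction_on with
  | _ n ih =>
    rw [gammaPoly_eq]
    refine Polynomial.natDegree_add_le_of_degree_le (natDegree_thetaPoly_le c n)
      ((Polynomial.natDegree_C_mul_le _ _).trans
        (Polynomial.natDegree_sum_le_of_forall_le _ _ fun k hk => ?_))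
    have hkn := Finset.mem_range.1 hk
    refine (Polynomial.natDegree_mul_le_of_le (ih (n - 1 - k) (by omega))
      (natDegree_thetaPoly_le c k)).trans (by omega)

theorem gammaPoly_coeff_eq_zero (c lam : ℝ) {n m : ℕ} (h : n < 2 * m) :
    (gammaPoly c lam n).coeff m = 0 :=
  Polynomial.coeff_eq_zero_of_natDegree_lt ((natDegree_gammaPoly_le c lam n).trans_lt (by omega))

theorem gammaPoly_coeff (c lam : ℝ) (n m : ℕ) :
    (gammaPoly c lam n).coeff m = (thetaPoly c n).coeff m + lam * ∑ k ∈ Finset.range n,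
      if k / 2 ≤ m then
        (gammaPoly c lam (n - 1 - k)).coeff (m - k / 2) * (thetaPoly c k).coeff (k / 2)
      else 0 := by
  rw [gammaPoly_eq, Polynomial.coeff_add, Polynomial.coeff_C_mul, Polynomial.finsetSum_coeff]
  simp only [coeff_mul_thetaPoly]

theorem gammaPoly_coeff_top (c lam : ℝ) (r : ℕ) :
    (gammaPoly c lam (2 * r)).coeff r = (-1) ^ r / (2 * r + 1) * c ^ (2 * r) := by
  rw [gammaPoly_coeff, Finset.sum_eq_zero]
  · simp [thetaPoly]
  · intro k hk
    have := Finset.mem_range.1 hk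
    split_ifs
    · rw [gammaPoly_coeff_eq_zero c lam (by omega), zero_mul]
    · rfl

theorem gammaPoly_seven_coeff_three (c lam : ℝ) :
    (gammaPoly c lam 7).coeff 3 = -(44 / 105) * lam * c ^ 6 := by
  have h0 := gammaPoly_coeff_top c lam 0
  have h2 := gammaPoly_coeff_top c lam 1
  have h4 := gammaPoly_coeff_top c lam 2
  have h6 := gammaPoly_coeff_top c lam 3
  norm_num at h0 h2 h4 h6
  have e : ¬ Even 1 ∧ Even 2 ∧ ¬ Even 3 ∧ Even 4 ∧ ¬ Even 5 ∧ Even 6 ∧ ¬ Even 7 := by decide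
  rw [gammaPoly_coeff]
  simp [Finset.sum_range_succ, thetaPoly, e, h0, h2, h4, h6]
  ring

theorem eval_thetaPoly (c : ℝ) (θ : ℕ → (Fin 3 → ℝ) → ℝ)
    (hθeven : ∀ (r : ℕ) (α : Fin 3 → ℝ), θ (2 * r) α = 0)
    (hθodd : ∀ (r : ℕ) (α : Fin 3 → ℝ), θ (2 * r + 1) α
      = (-1 : ℝ) ^ r * poch (1 / 2) r / poch (3 / 2) r
          * (c * Real.sqrt (∑ i, α i ^ 2)) ^ (2 * r)) (n : ℕ) (α : Fin 3 → ℝ) :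
    θ (n + 1) α = (thetaPoly c n).eval (∑ i, α i ^ 2) := by
  have hs : 0 ≤ ∑ i, α i ^ 2 := by positivity
  rcases Nat.even_or_odd' n with ⟨r, rfl | rfl⟩
  · rw [hθodd, mul_div_assoc, poch_half_div, mul_pow, pow_mul (Real.sqrt _), Real.sq_sqrt hs]
    simp [thetaPoly]
    ring
  · have : 2 * r + 1 + 1 = 2 * (r + 1) := by ring
    rw [this, hθeven]
    simp [thetaPoly]

theorem eval_gammaPoly (c lam : ℝ) (θ γ : ℕ → (Fin 3 → ℝ) → ℝ) (α : Fin 3 → ℝ)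
    (hθ : ∀ n, θ (n + 1) α = (thetaPoly c n).eval (∑ i, α i ^ 2))
    (hγ1 : γ 1 α = 1)
    (hγ : ∀ n : ℕ, 2 ≤ n →
      γ n α = θ n α + lam * ∑ k ∈ Finset.Icc 1 (n - 1), γ (n - k) α * θ k α) (n : ℕ) :
    γ (n + 1) α = (gammaPoly c lam n).eval (∑ i, α i ^ 2) := by
  induction n using Nat.strong_induction_on with
  | _ n ih =>
    rcases Nat.eq_zero_or_pos n with rfl | hn
    · rw [gammaPoly_eq]
      simp [hγ1, thetaPoly]
    · rw [hγ (n + 1) (by omega), gammaPoly_eq, hθ, Polynomial.eval_add, Polynomial.eval_mul,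
        Polynomial.eval_C, Polynomial.eval_finsetSum]
      congr 2
      have hIcc : Finset.Icc 1 (n + 1 - 1) = Finset.Ico 1 (n + 1) := by
        ext k
        simp
      rw [hIcc, Finset.sum_Ico_eq_sum_range]
      refine Finset.sum_congr (by simp) fun k hk => ?_
      have hkn := Finset.mem_range.1 hk
      have h1 : n + 1 - (1 + k) = (n - 1 - k) + 1 := by omega
      rw [h1, add_comm 1 k, hθ, ih _ (by omega), Polynomial.eval_mul]

/-- The general term of the double series for `H`, in powers of `t` and of `s = ‖α‖²`. -/
noncomputable def gammaTerm (c lam t : ℝ) (s : ℝ) (n m : ℕ) : ℝ :=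
  (gammaPoly c lam n).coeff m * s ^ m * (t ^ n / n.factorial)

theorem summable_gammaTerm {c lam : ℝ} (hc : 0 ≤ c) (hlam : 0 ≤ lam) (t s : ℝ) :
    Summable fun p : ℕ × ℕ => gammaTerm c lam t s p.1 p.2 := by
  set R : ℝ := 2 * |s| + 1 with hR
  have hR1 : 1 ≤ R := by have := abs_nonneg s; linarith
  have h1 : Summable fun n : ℕ => ((c + lam) * |t| * R) ^ n / n.factorial :=
    Real.summable_pow_div_factorial _
  have h2 : Summable fun m : ℕ => (|s| / R) ^ m := by
    refine summable_geometric_of_lt_one (by positivity) ?_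
    rw [div_lt_one (by positivity)]
    have := abs_nonneg s
    linarith
  refine Summable.of_norm_bounded (h1.mul_of_nonneg h2 (fun n => by positivity)
    (fun m => by positivity)) ?_
  rintro ⟨n, m⟩
  simp only [gammaTerm, Real.norm_eq_abs]
  rcases lt_or_ge n m with hnm | hnm
  · rw [gammaPoly_coeff_eq_zero c lam (by omega)]
    simp only [zero_mul, abs_zero]
    positivity
  · rw [abs_mul, abs_mul, abs_div, abs_pow, abs_pow, Nat.abs_cast]
    calc _ ≤ (c + lam) ^ n * ((|s| / R) ^ m * R ^ n) * (|t| ^ n / n.factorial) := by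
          gcongr
          · exact abs_gammaPoly_coeff_le hc hlam n m
          · calc |s| ^ m = (|s| / R) ^ m * R ^ m := by
                  rw [← mul_pow, div_mul_cancel₀ _ (by positivity)]
              _ ≤ _ := by gcongr
      _ = _ := by rw [mul_pow, mul_pow]; ring

/-- The coefficient of `s ^ m` in the double series for `H`. -/
noncomputable def momentCoeff (c lam t : ℝ) (m : ℕ) : ℝ := ∑' n : ℕ, gammaTerm c lam t 1 n m

theorem tsum_gammaTerm_fst (c lam t s : ℝ) (m : ℕ) :
    ∑' n : ℕ, gammaTerm c lam t s n m = momentCoeff c lam t m * s ^ m := by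
  rw [momentCoeff, ← tsum_mul_right]
  exact tsum_congr fun n => by simp only [gammaTerm]; ring

theorem tsum_gammaTerm_snd (c lam t s : ℝ) (n : ℕ) :
    ∑' m : ℕ, gammaTerm c lam t s n m =
      (gammaPoly c lam n).eval s / n.factorial * t ^ n := by
  rw [tsum_eq_sum (s := Finset.range ((gammaPoly c lam n).natDegree + 1)),
    Polynomial.eval_eq_sum_range, div_mul_eq_mul_div, mul_div_assoc, Finset.sum_mul]
  · rfl
  · intro m hm
    rw [gammaTerm, Polynomial.coeff_eq_zero_of_natDegree_lt]
    · simp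
    · simpa [Nat.lt_succ_iff] using hm

theorem summable_momentCoeff {c lam : ℝ} (hc : 0 ≤ c) (hlam : 0 ≤ lam) (t s : ℝ) :
    Summable fun m => momentCoeff c lam t m * s ^ m := by
  have := (summable_gammaTerm hc hlam t s).prod_symm.prod
  simpa only [Prod.swap, tsum_gammaTerm_fst] using this

theorem tsum_eval_gammaPoly {c lam : ℝ} (hc : 0 ≤ c) (hlam : 0 ≤ lam) (t s : ℝ) :
    ∑' n : ℕ, (gammaPoly c lam n).eval s / n.factorial * t ^ n =
      ∑' m : ℕ, momentCoeff c lam t m * s ^ m := by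
  simp only [← tsum_gammaTerm_fst, ← tsum_gammaTerm_snd]
  exact (summable_gammaTerm hc hlam t s).prod_symm.tsum_comm

/-- An everywhere convergent real power series is smooth, with the expected derivatives at `0`. -/
theorem contDiff_tsum_mul_pow (a : ℕ → ℝ) (ha : ∀ s : ℝ, Summable fun m => a m * s ^ m) :
    ContDiff ℝ ⊤ (fun s : ℝ => ∑' m, a m * s ^ m) ∧
      ∀ k : ℕ, iteratedDeriv k (fun s : ℝ => ∑' m, a m * s ^ m) 0 = k.factorial * a k := by
  have hrad : (FormalMultilinearSeries.ofScalars ℝ a).radius = ⊤ := by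
    refine FormalMultilinearSeries.radius_eq_top_of_summable_norm _ fun r => ?_
    have := (ha r).norm
    simpa [FormalMultilinearSeries.ofScalars_norm] using this
  have h := (FormalMultilinearSeries.ofScalars ℝ a).hasFPowerSeriesOnBall (by rw [hrad]; simp)
  have hsum : (FormalMultilinearSeries.ofScalars ℝ a).sum = fun s : ℝ => ∑' m, a m * s ^ m := by
    ext s
    simp [FormalMultilinearSeries.sum, mul_comm]
  rw [hsum, hrad] at h
  refine ⟨?_, fun k => ?_⟩
  · have := h.analyticOnNhd
    rw [Metric.eball_top] at this
    exact (contDiffOn_univ.1 this.contDiffOn_of_completeSpace)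
  · have := h.factorial_smul (1 : ℝ) k
    rw [iteratedDeriv_eq_iteratedFDeriv, ← this]
    simp

theorem pd_pd (i : Fin 3) (f : (Fin 3 → ℝ) → ℝ) (x : Fin 3 → ℝ) :
    pd i (pd i f) x = deriv (deriv fun u : ℝ => f (Function.update x i u)) (x i) := by
  have : (fun u => pd i f (Function.update x i u)) =
      deriv fun u : ℝ => f (Function.update x i u) := by
    ext u
    simp [pd]
  rw [← this]
  rfl

theorem deriv_deriv_comp_sq_add {F : ℝ → ℝ} (hF : ContDiff ℝ 2 F) (b : ℝ) :
    deriv (deriv fun u : ℝ => F (u ^ 2 + b)) 0 = 2 * deriv F b := by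
  have hF' : Differentiable ℝ F := hF.differentiable (by norm_num)
  have hF'' : Differentiable ℝ (deriv F) := by
    have : ContDiff ℝ 1 (deriv F) := (contDiff_succ_iff_deriv (n := 1).1 hF).2.2
    exact this.differentiable (by norm_num)
  have hq : ∀ u : ℝ, HasDerivAt (fun u : ℝ => u ^ 2 + b) (2 * u) u := fun u => by
    simpa using (hasDerivAt_pow 2 u).add_const b
  have h1 : (deriv fun u : ℝ => F (u ^ 2 + b)) = fun u => deriv F (u ^ 2 + b) * (2 * u) := by
    ext u
    exact ((hF' _).hasDerivAt.comp u (hq u)).deriv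
  rw [h1]
  have h2 := ((hF'' _).hasDerivAt.comp (0 : ℝ) (hq 0)).mul ((hasDerivAt_id (0 : ℝ)).const_mul 2)
  have h3 := h2.deriv
  simp only [Function.comp_def, Pi.mul_def, id] at h3
  rw [h3]
  simp [mul_comm]

theorem pd_six_comp_sum_sq {F : ℝ → ℝ} (hF : ContDiff ℝ ⊤ F) :
    pd 0 (pd 0 (pd 1 (pd 1 (pd 2 (pd 2 fun α => F (∑ i, α i ^ 2)))))) (fun _ => 0) =
      8 * iteratedDeriv 3 F 0 := by
  have hsmooth : ∀ k : ℕ, ContDiff ℝ 2 (iteratedDeriv k F) := fun k => by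
    rw [iteratedDeriv_eq_iterate]
    exact ContDiff.iterate_deriv' 2 k (hF.of_le le_top)
  have hcd : ∀ a : ℝ, ∀ k : ℕ, ContDiff ℝ 2 (fun s => a * iteratedDeriv k F s) := fun a k =>
    contDiff_const.mul (hsmooth k)
  have hd : ∀ (a : ℝ) (k : ℕ) (b : ℝ),
      deriv (deriv fun u : ℝ => a * iteratedDeriv k F (u ^ 2 + b)) 0 =
        2 * a * iteratedDeriv (k + 1) F b := fun a k b => by
    rw [deriv_deriv_comp_sq_add (hcd a k), deriv_const_mul _
      ((hsmooth k).differentiable (by norm_num) b), iteratedDeriv_succ, mul_assoc]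
  have h2 : ∀ x : Fin 3 → ℝ, x 2 = 0 →
      pd 2 (pd 2 fun α => F (∑ i, α i ^ 2)) x = 2 * iteratedDeriv 1 F (x 1 ^ 2 + x 0 ^ 2) := by
    intro x hx
    have := hd 1 0 (x 1 ^ 2 + x 0 ^ 2)
    rw [pd_pd, hx, ← mul_one (2 : ℝ), ← this]
    simp [Fin.sum_univ_three, Function.update_apply, add_comm]
  have h1 : ∀ x : Fin 3 → ℝ, x 1 = 0 → x 2 = 0 →
      pd 1 (pd 1 (pd 2 (pd 2 fun α => F (∑ i, α i ^ 2)))) x =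
        4 * iteratedDeriv 2 F (x 0 ^ 2) := by
    intro x hx1 hx2
    have h : ∀ u : ℝ, pd 2 (pd 2 fun α => F (∑ i, α i ^ 2)) (Function.update x 1 u) =
        2 * iteratedDeriv 1 F (u ^ 2 + x 0 ^ 2) := fun u => by
      rw [h2 _ (by simpa [Function.update_apply] using hx2)]
      simp
    rw [pd_pd, hx1]
    simp only [h]
    rw [hd]
    norm_num
  have h : ∀ u : ℝ, pd 1 (pd 1 (pd 2 (pd 2 fun α => F (∑ i, α i ^ 2))))
      (Function.update (fun _ => 0) 0 u) = 4 * iteratedDeriv 2 F (u ^ 2 + 0) := fun u => by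
    rw [h1 _ (by simp) (by simp)]
    simp
  rw [pd_pd]
  simp only [h]
  rw [hd]
  norm_num

theorem isLittleO_momentCoeff_three {c lam : ℝ} (hc : 0 ≤ c) (hlam : 0 ≤ lam) :
    (fun t : ℝ => momentCoeff c lam t 3 +
      (c ^ 6 * t ^ 6 / 5040 + 44 / 529200 * lam * c ^ 6 * t ^ 7))
      =o[nhdsWithin 0 (Set.Ioi 0)] fun t : ℝ => t ^ 7 := by
  have hsum : ∀ t, Summable fun n => gammaTerm c lam t 1 n 3 := fun t =>
    (summable_gammaTerm hc hlam t 1).prod_symm.prod_factor 3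
  set a : ℕ → ℝ := fun n => gammaTerm c lam 1 1 n 3 with ha
  have hterm : ∀ t n, gammaTerm c lam t 1 n 3 = a n * t ^ n := fun t n => by
    simp only [ha, gammaTerm]
    ring
  have hzero : ∀ n < 6, a n = 0 := fun n hn => by
    simp only [ha, gammaTerm]
    rw [gammaPoly_coeff_eq_zero c lam (by omega)]
    simp
  have hO : (fun t : ℝ => momentCoeff c lam t 3 +
      (c ^ 6 * t ^ 6 / 5040 + 44 / 529200 * lam * c ^ 6 * t ^ 7))
      =O[nhdsWithin 0 (Set.Ioi 0)] fun t : ℝ => t ^ 8 := by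
    have habs : Summable fun n => |a (n + 8)| :=
      ((summable_nat_add_iff 8).2 (hsum 1)).abs
    refine Asymptotics.IsBigO.of_bound (∑' n, |a (n + 8)|) ?_
    filter_upwards [Ioc_mem_nhdsGT (zero_lt_one' ℝ)] with t ht
    have hsplit : momentCoeff c lam t 3 +
        (c ^ 6 * t ^ 6 / 5040 + 44 / 529200 * lam * c ^ 6 * t ^ 7) =
        ∑' n, a (n + 8) * t ^ (n + 8) := by
      rw [momentCoeff, ← (hsum t).sum_add_tsum_nat_add 8]
      simp only [hterm]
      rw [Finset.sum_range_succ, Finset.sum_range_succ, Finset.sum_eq_zero fun n hn => by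
        rw [hzero n (Finset.mem_range.1 hn), zero_mul]]
      simp only [ha, gammaTerm, gammaPoly_coeff_top c lam 3, gammaPoly_seven_coeff_three,
        Nat.factorial]
      push_cast
      ring
    rw [hsplit, ← tsum_mul_right]
    have hb : Summable fun n => |a (n + 8)| * ‖t ^ 8‖ := habs.mul_right _
    refine tsum_of_norm_bounded hb.hasSum fun n => ?_
    rw [pow_add, norm_mul, norm_mul, Real.norm_eq_abs (a _)]
    have : ‖t ^ n‖ ≤ 1 := by
      rw [norm_pow, Real.norm_eq_abs, abs_of_pos ht.1]
      exact pow_le_one₀ ht.1.le ht.2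
    gcongr
    exact mul_le_of_le_one_left (norm_nonneg _) this
  exact hO.trans_isLittleO
    ((Asymptotics.isLittleO_pow_pow (by norm_num : 7 < 8)).mono nhdsWithin_le_nhds)


/-- Theorem 3, second part: the second mixed moment
`μ_{(2,2,2)}(t) = (-i)⁶ ∂⁶H/∂α₁²∂α₂²∂α₃² |_{α=0}` of the three-dimensional symmetric
Markov random flight satisfies, as `t → 0⁺`,
`μ_{(2,2,2)}(t) = e^{-λt} [ (ct)⁶/105 + λ (44/11025) c⁶ t⁷ ] + o(t⁷)`. -/
theorem stmt14 (c lam : ℝ) (hc : 0 < c) (hlam : 0 < lam)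
    (θ γ : ℕ → (Fin 3 → ℝ) → ℝ)
    (hθeven : ∀ (r : ℕ) (α : Fin 3 → ℝ), θ (2 * r) α = 0)
    (hθodd : ∀ (r : ℕ) (α : Fin 3 → ℝ), θ (2 * r + 1) α
      = (-1 : ℝ) ^ r * poch (1 / 2) r / poch (3 / 2) r
          * (c * Real.sqrt (∑ i, α i ^ 2)) ^ (2 * r))
    (hγ1 : ∀ α : Fin 3 → ℝ, γ 1 α = 1)
    (hγ : ∀ n : ℕ, 2 ≤ n → ∀ α : Fin 3 → ℝ,
      γ n α = θ n α + lam * ∑ k ∈ Finset.Icc 1 (n - 1), γ (n - k) α * θ k α)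
    (H : (Fin 3 → ℝ) → ℝ → ℝ)
    (hH : ∀ (α : Fin 3 → ℝ) (t : ℝ),
      H α t = Real.exp (-lam * t) * ∑' n : ℕ, γ (n + 1) α / n.factorial * t ^ n)
    (μ : ℝ → ℂ)
    (hμ : ∀ t : ℝ, μ t = (-Complex.I) ^ 6 *
      ((pd 0 (pd 0 (pd 1 (pd 1 (pd 2 (pd 2 (fun α => H α t)))))) (fun _ => 0) : ℝ) : ℂ)) :
    (fun t : ℝ => μ t -
        ((Real.exp (-lam * t) * ((c * t) ^ 6 / 105 + lam * (44 / 11025) * c ^ 6 * t ^ 7) : ℝ) : ℂ))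
      =o[nhdsWithin 0 (Set.Ioi 0)] fun t : ℝ => t ^ 7 := by
  have hH' : ∀ t, (fun α => H α t) = fun α => (fun s : ℝ => ∑' m : ℕ,
      (Real.exp (-lam * t) * momentCoeff c lam t m) * s ^ m) (∑ i, α i ^ 2) := by
    intro t
    ext α
    simp only [mul_assoc]
    rw [hH, tsum_mul_left, ← tsum_eval_gammaPoly hc.le hlam.le]
    simp only [eval_gammaPoly c lam θ γ α (fun n => eval_thetaPoly c θ hθeven hθodd n α)
      (hγ1 α) fun n hn => hγ n hn α]
  have hμ' : ∀ t, μ t = ((-(48 * Real.exp (-lam * t) * momentCoeff c lam t 3) : ℝ) : ℂ) := by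
    intro t
    obtain ⟨hsmooth, hderiv⟩ := contDiff_tsum_mul_pow
      (fun m => Real.exp (-lam * t) * momentCoeff c lam t m) fun s => by
        simpa only [mul_assoc] using (summable_momentCoeff hc.le hlam.le t s).mul_left _
    have hI : (-Complex.I) ^ 6 = -1 := by
      rw [show 6 = 2 * 3 from rfl, pow_mul, neg_sq, Complex.I_sq]
      norm_num
    rw [hμ, hH', pd_six_comp_sum_sq hsmooth, hderiv, hI]
    simp only [Nat.factorial]
    push_cast
    ring
  have hbd : (fun t : ℝ => -(48 * Real.exp (-lam * t)))
      =O[nhdsWithin 0 (Set.Ioi 0)] fun _ : ℝ => (1 : ℝ) := by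
    have hcont : Continuous fun t : ℝ => -(48 * Real.exp (-lam * t)) := by fun_prop
    exact (hcont.tendsto 0).mono_left nhdsWithin_le_nhds |>.isBigO_one ℝ
  have hmain := hbd.mul_isLittleO (isLittleO_momentCoeff_three hc.le hlam.le)
  simp only [one_mul] at hmain
  refine Asymptotics.IsLittleO.of_norm_left (hmain.norm_left.congr_left fun t => ?_)
  rw [hμ', ← Complex.ofReal_sub, Complex.norm_real]
  congr 1
  ring
end
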